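/- arXiv:1703.00723 — 13 statements merged into one kernel-verified Lean document; each statement's English description precedes it below -/
import Mathlib

section
/- Suppose a wiretap-and-addition attack model (K_B, H_B, K_E, H_E) over F_q together with a strategy α = (α_1, …, α_{m5}) and subsets w_1, …, w_{m5} ⊆ {1, …, m6} satisfies the causal condition: each component α_i depends only on the coordinates Y_{E,j} of Eve's observation with j ∈ w_i, (A1) the (j,i) entry of H_E is 0 for every j ∈ w_i, and (A2) w_1 ⊆ w_2 ⊆ … ⊆ w_{m5}. Then (K, H, α) satisfies the uniqueness condition: for every x ∈ F_q^{m3} there exists a unique y ∈ F_q^{m6} with y = K_E x + H_E α(y). -/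
/-- A self-map of `Fin n → R` whose `i`-th output depends only on the inputs with index less
than `i` has a unique fixed point. -/
theorem existsUnique_isFixedPt_of_strictly_causal {R : Type*} [Nonempty R] {n : ℕ}
    (G : (Fin n → R) → (Fin n → R))
    (hG : ∀ i a b, (∀ j < i, a j = b j) → G a i = G b i) :
    ∃! a, Function.IsFixedPt G a := by
  obtain ⟨r⟩ := ‹Nonempty R›
  have stable : ∀ (k : ℕ) (i : Fin n), (i : ℕ) < k →
      G (G^[k] fun _ => r) i = (G^[k] fun _ => r) i := by
    intro k
    induction k with
    | zero => intro i hi; omega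
    | succ k ih =>
      intro i hi
      rw [Function.iterate_succ_apply']
      exact hG i _ _ fun j hj => ih j (by have : (j : ℕ) < i := hj; omega)
  refine ⟨G^[n] fun _ => r, funext fun i => stable n i i.isLt, fun b hb => ?_⟩
  funext i
  induction i using WellFoundedLT.induction with
  | ind i ih => exact (congrFun hb i).symm.trans ((hG i _ _ ih).trans (stable n i i.isLt))


/-- If a wiretap-and-addition attack model together with a strategy `α` and
subsets `w i` satisfies the causal condition ((dependence), (A1), (A2)), then it satisfies
the uniqueness condition. -/
theorem causal_implies_uniqueness
    (F : Type) [Field F] [Fintype F] (m3 m4 m5 m6 : ℕ)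
    (KB : Matrix (Fin m4) (Fin m3) F) (HB : Matrix (Fin m4) (Fin m5) F)
    (KE : Matrix (Fin m6) (Fin m3) F) (HE : Matrix (Fin m6) (Fin m5) F)
    (α : (Fin m6 → F) → (Fin m5 → F))
    (w : Fin m5 → Finset (Fin m6))
    (hdep : ∀ (i : Fin m5) (y y' : Fin m6 → F), (∀ j ∈ w i, y j = y' j) → α y i = α y' i)
    (hA1 : ∀ (i : Fin m5), ∀ j ∈ w i, HE j i = 0)
    (hA2 : ∀ i i' : Fin m5, i ≤ i' → w i ⊆ w i') :
    ∀ x : Fin m3 → F, ∃! y : Fin m6 → F, y = KE.mulVec x + HE.mulVec (α y) := by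
  intro x
  obtain ⟨a, ha, huniq⟩ := existsUnique_isFixedPt_of_strictly_causal
    (fun a => α (KE.mulVec x + HE.mulVec a)) (by
      intro i a b hab
      refine hdep i _ _ fun j hj => congrArg (KE.mulVec x j + ·) ?_
      simp only [Matrix.mulVec, dotProduct]
      refine Finset.sum_congr rfl fun k _ => ?_
      rcases lt_or_ge k i with hk | hk
      · rw [hab k hk]
      · simp only [hA1 k j (hA2 i k hk hj), zero_mul])
  refine ⟨KE.mulVec x + HE.mulVec a, ?_, fun y hy => ?_⟩
  · exact congrArg (KE.mulVec x + HE.mulVec ·) ha.symm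
  · have h : α y = a := huniq (α y) (congrArg α hy.symm)
    rw [hy, h]
end

section
/- (Reduction Theorem) Fix a code Φ_n, matrices (K_B, H_B, K_E, H_E), and a strategy α^n satisfying the uniqueness condition. Let X^n := φ_n(M, L) and let Y_E^n be Eve's observation under the active attack, i.e., the unique solution of y^n = K_E X^n + H_E α^n(y^n). Then Y_E^n is a deterministic function of K_E X^n and K_E X^n is a deterministic function of Y_E^n; consequently the mutual information satisfies I(M; Y_E^n) = I(M; K_E X^n), i.e., the information leaked to Eve under any active attack satisfying the uniqueness condition equals the information leaked under the passive attack. -/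
/-- Probability of an event under the uniform distribution on a finite type. -/
noncomputable def prU {Ω : Type*} [Fintype Ω] (E : Ω → Prop) : ℝ :=
  (Nat.card {ω : Ω // E ω} : ℝ) / (Fintype.card Ω : ℝ)

/-- Shannon entropy (natural logarithm) of a random variable on a finite type equipped
with the uniform distribution. -/
noncomputable def entU {Ω A : Type*} [Fintype Ω] [Fintype A] (X : Ω → A) : ℝ :=
  -∑ a : A, prU (fun ω => X ω = a) * Real.log (prU (fun ω => X ω = a))

/-- Shannon mutual information (natural logarithm) of two random variables on a finite type
equipped with the uniform distribution. -/
noncomputable def miU {Ω A B : Type*} [Fintype Ω] [Fintype A] [Fintype B]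
    (X : Ω → A) (Y : Ω → B) : ℝ :=
  entU X + entU Y - entU (fun ω => (X ω, Y ω))

theorem exists_of_prU_mul_log_ne_zero {Ω : Type*} [Fintype Ω] {E : Ω → Prop}
    (h : prU E * Real.log (prU E) ≠ 0) : ∃ ω, E ω := by
  by_contra! hE
  have : IsEmpty {ω : Ω // E ω} := ⟨fun ω => hE ω.1 ω.2⟩
  exact h (by simp [prU])

/-- Random variables that are functions of each other have the same entropy. -/
theorem entU_eq_of_comp {Ω A B : Type*} [Fintype Ω] [Fintype A] [Fintype B]
    {X : Ω → A} {Y : Ω → B} {f : B → A} {g : A → B}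
    (hf : ∀ ω, X ω = f (Y ω)) (hg : ∀ ω, Y ω = g (X ω)) : entU X = entU Y := by
  have event_eq (ω₀ : Ω) : (fun ω => X ω = X ω₀) = fun ω => Y ω = Y ω₀ := by
    funext ω
    exact propext ⟨fun h => by rw [hg, h, ← hg], fun h => by rw [hf, h, ← hf]⟩
  unfold entU
  congr 1
  refine Finset.sum_bij_ne_zero (fun a _ _ => g a) (fun _ _ _ => Finset.mem_univ _) ?_ ?_ ?_
  · intro a _ ha b _ hb hab
    obtain ⟨ω, rfl⟩ := exists_of_prU_mul_log_ne_zero ha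
    obtain ⟨ω', rfl⟩ := exists_of_prU_mul_log_ne_zero hb
    rw [hf ω, hf ω', hg ω, hg ω', hab]
  · intro b _ hb
    obtain ⟨ω, rfl⟩ := exists_of_prU_mul_log_ne_zero hb
    exact ⟨X ω, Finset.mem_univ _, by rwa [event_eq], (hg ω).symm⟩
  · intro a _ ha
    obtain ⟨ω, rfl⟩ := exists_of_prU_mul_log_ne_zero ha
    simp only [← hg, event_eq]

/-- Mutual information is unchanged when the second variable is replaced by one that
determines it and is determined by it. -/
theorem miU_eq_of_comp {Ω A B C : Type*} [Fintype Ω] [Fintype A] [Fintype B] [Fintype C]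
    (X : Ω → A) {Y : Ω → B} {Z : Ω → C} {f : C → B} {g : B → C}
    (hf : ∀ ω, Y ω = f (Z ω)) (hg : ∀ ω, Z ω = g (Y ω)) : miU X Y = miU X Z := by
  have pair_eq : entU (fun ω => (X ω, Y ω)) = entU (fun ω => (X ω, Z ω)) :=
    entU_eq_of_comp (f := Prod.map id f) (g := Prod.map id g)
      (fun ω => by simp [← hf]) (fun ω => by simp [← hg])
  rw [miU, miU, pair_eq, entU_eq_of_comp hf hg]

/-- Reduction Theorem: for a code `(φ, ψ)`, matrices `(K_B, H_B, K_E, H_E)`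
and a strategy `αn` satisfying the uniqueness condition, Eve's observation `Y_E^n` under the
active attack (the unique fixed point) is a deterministic function of the passive observation
`K_E X^n` and vice versa; consequently `I(M; Y_E^n) = I(M; K_E X^n)`. -/
theorem reduction_theorem
    (F : Type) [Field F] [Fintype F] (kn ln m3 m4 m5 m6 : ℕ)
    (Lset : Type) [Fintype Lset] [Nonempty Lset]
    (φ : (Fin kn → F) → Lset → Matrix (Fin m3) (Fin ln) F)
    (ψ : Matrix (Fin m4) (Fin ln) F → (Fin kn → F))
    (KB : Matrix (Fin m4) (Fin m3) F) (HB : Matrix (Fin m4) (Fin m5) F)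
    (KE : Matrix (Fin m6) (Fin m3) F) (HE : Matrix (Fin m6) (Fin m5) F)
    (αn : Matrix (Fin m6) (Fin ln) F → Matrix (Fin m5) (Fin ln) F)
    (huniq : ∀ x : Matrix (Fin m3) (Fin ln) F,
      ∃! y : Matrix (Fin m6) (Fin ln) F, y = KE * x + HE * αn y)
    (YE : (Fin kn → F) × Lset → Matrix (Fin m6) (Fin ln) F)
    (hYE : ∀ ω, YE ω = KE * φ ω.1 ω.2 + HE * αn (YE ω)) :
    (∃ f : Matrix (Fin m6) (Fin ln) F → Matrix (Fin m6) (Fin ln) F,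
        ∀ ω, YE ω = f (KE * φ ω.1 ω.2)) ∧
    (∃ g : Matrix (Fin m6) (Fin ln) F → Matrix (Fin m6) (Fin ln) F,
        ∀ ω, KE * φ ω.1 ω.2 = g (YE ω)) ∧
    miU (fun ω : (Fin kn → F) × Lset => ω.1) YE =
      miU (fun ω : (Fin kn → F) × Lset => ω.1)
        (fun ω : (Fin kn → F) × Lset => KE * φ ω.1 ω.2) := by
  have hg (ω : (Fin kn → F) × Lset) : KE * φ ω.1 ω.2 = YE ω - HE * αn (YE ω) :=
    eq_sub_of_add_eq (hYE ω).symm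
  have hfactor : YE.FactorsThrough fun ω => KE * φ ω.1 ω.2 := by
    intro ω ω' h
    refine (huniq (φ ω.1 ω.2)).unique (hYE ω) ?_
    rw [show KE * φ ω.1 ω.2 = KE * φ ω'.1 ω'.2 from h]
    exact hYE ω'
  obtain ⟨f, hf⟩ := (Function.factorsThrough_iff YE).1 hfactor
  exact ⟨⟨f, congrFun hf⟩, ⟨fun y => y - HE * αn y, hg⟩,
    miU_eq_of_comp (g := fun y => y - HE * αn y) _ (congrFun hf) hg⟩
end

section
/- Assume m2 + m1 < m0. There exists a sequence of codes Φ_n of block-length l_n over the finite field F_q with message set F_q^{k_n} such that: (i) k_n / l_n → m0 − m1 − m2 as n → ∞; (ii) for every ε > 0 there is N such that for all n ≥ N, for all natural numbers m5, m6, all matrices (K_B, H_B, K_E, H_E) with rank K_B = m0, rank H_B = m1, rank K_E = m2, and all strategies α^n satisfying the uniqueness condition, P_e[Φ_n, K, H, α^n] ≤ ε (robustness); and (iii) for all sufficiently large n, for all such matrices and strategies, the mutual information I(M; Y_E^n) equals 0 (secrecy against active attacks). -/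
section LinearAlgebra

variable {F V V' : Type*} [Field F] [AddCommGroup V] [Module F V] [AddCommGroup V'] [Module F V']

theorem Submodule.finrank_map_add_finrank_ker_inf [FiniteDimensional F V] (f : V →ₗ[F] V')
    (P : Submodule F V) :
    Module.finrank F (P.map f) + Module.finrank F (LinearMap.ker f ⊓ P : Submodule F V)
      = Module.finrank F P := by
  have h := LinearMap.finrank_range_add_finrank_ker (f.domRestrict P)
  rw [LinearMap.range_domRestrict, LinearMap.ker_domRestrict] at h
  rw [← h, inf_comm, ← Submodule.map_comap_subtype]
  congr 1
  exact ((Submodule.equivMapOfInjective _ P.injective_subtype _).finrank_eq).symm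

theorem Submodule.finrank_comap_le [FiniteDimensional F V] [FiniteDimensional F V']
    (f : V →ₗ[F] V') (P : Submodule F V') :
    Module.finrank F (P.comap f) ≤ Module.finrank F P + Module.finrank F (LinearMap.ker f) := by
  rw [← Submodule.finrank_map_add_finrank_ker_inf f (P.comap f)]
  exact Nat.add_le_add (Submodule.finrank_mono (Submodule.map_comap_le f P))
    (Submodule.finrank_mono inf_le_left)

theorem Matrix.rank_add_finrank_ker {m n : ℕ} (A : Matrix (Fin m) (Fin n) F) :
    A.rank + Module.finrank F (LinearMap.ker A.mulVecLin) = n := by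
  have := LinearMap.finrank_range_add_finrank_ker A.mulVecLin
  rwa [Module.finrank_fin_fun] at this

theorem Matrix.rank_add_rank_le_rank_mul_add {l m n : ℕ} (A : Matrix (Fin l) (Fin m) F)
    (B : Matrix (Fin m) (Fin n) F) : A.rank + B.rank ≤ (A * B).rank + m := by
  have h1 := Submodule.finrank_map_add_finrank_ker_inf A.mulVecLin (LinearMap.range B.mulVecLin)
  rw [← LinearMap.range_comp, ← Matrix.mulVecLin_mul] at h1
  have h2 := A.rank_add_finrank_ker
  have h3 : Module.finrank F (LinearMap.ker A.mulVecLin ⊓ LinearMap.range B.mulVecLin :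
    Submodule F (Fin m → F)) ≤ Module.finrank F (LinearMap.ker A.mulVecLin) :=
    Submodule.finrank_mono inf_le_left
  unfold Matrix.rank at *
  omega

theorem Submodule.exists_matrix_ker_eq {m r : ℕ} (U : Submodule F (Fin m → F))
    (h : m ≤ r + Module.finrank F U) :
    ∃ E : Matrix (Fin r) (Fin m) F, LinearMap.ker E.mulVecLin = U := by
  have h1 := U.finrank_quotient_add_finrank
  rw [Module.finrank_fin_fun] at h1
  obtain ⟨g, hg⟩ := (finrank_le_iff_exists_linearMap (R := F) (M := (Fin m → F) ⧸ U)
    (M' := Fin r → F)).1 (by rw [Module.finrank_fin_fun]; omega)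
  refine ⟨LinearMap.toMatrix' (g ∘ₗ U.mkQ), ?_⟩
  rw [← Matrix.toLin'_apply', Matrix.toLin'_toMatrix', LinearMap.ker_comp,
    LinearMap.ker_eq_bot.2 hg]
  exact Submodule.ker_mkQ U

theorem Submodule.exists_matrix_ker_comparable {m r : ℕ} (hr : r ≤ m)
    (W : Submodule F (Fin m → F)) :
    ∃ E : Matrix (Fin r) (Fin m) F, E.rank = r ∧
      (W ≤ LinearMap.ker E.mulVecLin ∨ LinearMap.ker E.mulVecLin ≤ W) := by
  have h1 := W.finrank_quotient_add_finrank
  rw [Module.finrank_fin_fun] at h1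
  rcases le_total (r + Module.finrank F W) m with h | h
  · obtain ⟨g, hg⟩ := (finrank_le_iff_exists_linearMap (R := F) (M := Fin r → F)
      (M' := (Fin m → F) ⧸ W)).1 (by rw [Module.finrank_fin_fun]; omega)
    obtain ⟨g', hg'⟩ := g.exists_leftInverse_of_injective (LinearMap.ker_eq_bot.2 hg)
    have hsurj : Function.Surjective g' := fun x => ⟨g x, LinearMap.congr_fun hg' x⟩
    refine ⟨LinearMap.toMatrix' (g' ∘ₗ W.mkQ), ?_, Or.inl ?_⟩
    · rw [Matrix.rank, ← Matrix.toLin'_apply', Matrix.toLin'_toMatrix',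
        LinearMap.range_eq_top.2 (by
          rw [LinearMap.coe_comp]; exact hsurj.comp W.mkQ_surjective), finrank_top,
        Module.finrank_fin_fun]
    · rw [← Matrix.toLin'_apply', Matrix.toLin'_toMatrix', LinearMap.ker_comp]
      conv_lhs => rw [← Submodule.ker_mkQ W]
      exact Submodule.comap_mono bot_le
  · obtain ⟨g, hg⟩ := (finrank_le_iff_exists_linearMap (R := F) (M := Fin (m - r) → F)
      (M' := W)).1 (by rw [Module.finrank_fin_fun]; omega)
    have hU : Module.finrank F (LinearMap.range (W.subtype ∘ₗ g)) = m - r := by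
      rw [LinearMap.finrank_range_of_inj (by
        rw [LinearMap.coe_comp]; exact W.injective_subtype.comp hg), Module.finrank_fin_fun]
    obtain ⟨E, hE⟩ := Submodule.exists_matrix_ker_eq (r := r) (LinearMap.range (W.subtype ∘ₗ g))
      (by omega)
    refine ⟨E, ?_, Or.inr ?_⟩
    · have := E.rank_add_finrank_ker
      rw [hE, hU] at this
      omega
    · rw [hE, LinearMap.range_comp]
      exact Submodule.map_subtype_le _ _

theorem Matrix.exists_annihilator {m l r : ℕ} (R : Matrix (Fin m) (Fin l) F) (hR : R.rank ≤ r) :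
    ∃ Q : Matrix (Fin m) (Fin m) F, Q * R = 0 ∧ m ≤ Q.rank + r := by
  obtain ⟨Q, hQ⟩ := Submodule.exists_matrix_ker_eq (r := m) (LinearMap.range R.mulVecLin)
    (by omega)
  refine ⟨Q, ?_, ?_⟩
  · apply Matrix.toLin'.injective
    rw [Matrix.toLin'_mul, map_zero]
    exact LinearMap.range_le_ker_iff.1 hQ.ge
  · have := Q.rank_add_finrank_ker
    rw [hQ] at this
    change _ + R.rank = _ at this
    omega

theorem Matrix.exists_rank_factorization {m n : ℕ} (A : Matrix (Fin m) (Fin n) F) :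
    ∃ (C : Matrix (Fin m) (Fin A.rank) F) (E : Matrix (Fin A.rank) (Fin n) F),
      E.rank = A.rank ∧ A = C * E := by
  let e : LinearMap.range A.mulVecLin ≃ₗ[F] (Fin A.rank → F) :=
    LinearEquiv.ofFinrankEq _ _ (by rw [Module.finrank_fin_fun]; rfl)
  let C := LinearMap.toMatrix' ((LinearMap.range A.mulVecLin).subtype ∘ₗ e.symm.toLinearMap)
  let E := LinearMap.toMatrix' (e.toLinearMap ∘ₗ A.mulVecLin.rangeRestrict)
  have hA : A = C * E := by
    apply Matrix.toLin'.injective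
    rw [Matrix.toLin'_mul, Matrix.toLin'_toMatrix', Matrix.toLin'_toMatrix']
    ext x
    simp
  refine ⟨C, E, le_antisymm ?_ ?_, hA⟩
  · simpa using E.rank_le_height
  · conv_lhs => rw [hA]
    exact Matrix.rank_mul_le_right C E

end LinearAlgebra

theorem card_matrix {F : Type} [Fintype F] (m l : ℕ) :
    Nat.card (Matrix (Fin m) (Fin l) F) = Fintype.card F ^ (m * l) := by
  change Nat.card (Fin m → Fin l → F) = _
  simp [← pow_mul, mul_comm]

theorem card_columns_mem {F : Type} [Field F] [Fintype F] {m l : ℕ}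
    (W : Submodule F (Fin m → F)) :
    Nat.card (Fin l → W) = Fintype.card F ^ (Module.finrank F W * l) := by
  rw [Nat.card_fun, Module.natCard_eq_pow_finrank (K := F), Nat.card_eq_fintype_card,
    Nat.card_eq_fintype_card, Fintype.card_fin, pow_mul]

section Counting

variable {F : Type} [Field F] [Fintype F] {r m l : ℕ}
  (S : Matrix (Fin r) (Fin l) F →ₗ[F] Matrix (Fin m) (Fin l) F)

theorem card_encoder_columns_mem_le
    (hS : ∀ E : Matrix (Fin r) (Fin m) F, E.rank = r → Function.Bijective (fun L => E * S L))
    (hrm : r ≤ m) (W : Submodule F (Fin m → F)) :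
    Nat.card {L // ∀ c, (S L).col c ∈ W} ≤
      Fintype.card F ^ ((Module.finrank F W + r - m) * l) := by
  obtain ⟨E, hE, hcomp⟩ := Submodule.exists_matrix_ker_comparable hrm W
  have hdim : Module.finrank F (W.map E.mulVecLin) ≤ Module.finrank F W + r - m := by
    rcases hcomp with h | h
    · rw [LinearMap.le_ker_iff_map.1 h, finrank_bot]
      exact Nat.zero_le _
    · have h1 := Submodule.finrank_map_add_finrank_ker_inf E.mulVecLin W
      rw [inf_eq_left.2 h] at h1
      have h2 := E.rank_add_finrank_ker
      omega
  have hcard : Nat.card {L // ∀ c, (S L).col c ∈ W} ≤ Nat.card (Fin l → W.map E.mulVecLin) := by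
    refine Nat.card_le_card_of_injective
      (fun L c => ⟨E.mulVecLin ((S L.1).col c), Submodule.mem_map_of_mem (L.2 c)⟩) ?_
    intro L L' h
    apply Subtype.ext
    apply (hS E hE).1
    ext i c
    have := congrArg Subtype.val (congrFun h c)
    exact congrFun this i
  refine hcard.trans ?_
  rw [card_columns_mem]
  exact Nat.pow_le_pow_right Fintype.card_pos (Nat.mul_le_mul_right l hdim)

theorem card_homogeneous_solutions_le {p g : ℕ}
    (hS : ∀ E : Matrix (Fin r) (Fin m) F, E.rank = r → Function.Bijective (fun L => E * S L))
    (E : Matrix (Fin r) (Fin m) F)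
    (G G' : Matrix (Fin p) (Fin m) F) (hE : E.rank = r) (hG : g ≤ G.rank) (hG' : g ≤ G'.rank) :
    Nat.card {z : Matrix (Fin m) (Fin l) F × Matrix (Fin r) (Fin l) F //
      E * z.1 = 0 ∧ G * z.1 = G' * S z.2} ≤ Fintype.card F ^ ((m - g) * l) := by
  classical
  let κ : Submodule F (Fin m → F) := LinearMap.ker G.mulVecLin ⊓ LinearMap.ker E.mulVecLin
  let W : Submodule F (Fin m → F) :=
    ((LinearMap.ker E.mulVecLin).map G.mulVecLin).comap G'.mulVecLin
  have hgm : G.rank ≤ m := by simpa using G.rank_le_width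
  have h1 := Submodule.finrank_map_add_finrank_ker_inf G.mulVecLin (LinearMap.ker E.mulVecLin)
  have h2 : Module.finrank F W ≤ _ := Submodule.finrank_comap_le G'.mulVecLin
    ((LinearMap.ker E.mulVecLin).map G.mulVecLin)
  have h3 : Module.finrank F κ ≤ _ := Submodule.finrank_mono inf_le_left
  have h4 := E.rank_add_finrank_ker
  have h5 := G.rank_add_finrank_ker
  have h6 := G'.rank_add_finrank_ker
  have hdim : Module.finrank F κ + (Module.finrank F W + r - m) ≤ m - g := by
    change _ + Module.finrank F κ = _ at h1
    omega
  let Z : Matrix (Fin r) (Fin l) F → Matrix (Fin m) (Fin l) F → Prop :=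
    fun L z => E * z = 0 ∧ G * z = G' * S L
  let z₀ : Matrix (Fin r) (Fin l) F → Matrix (Fin m) (Fin l) F :=
    fun L => if h : ∃ z, Z L z then h.choose else 0
  have hz₀ : ∀ L z, Z L z → Z L (z₀ L) := by
    intro L z h
    have hex : ∃ z, Z L z := ⟨z, h⟩
    simp only [z₀, dif_pos hex]
    exact hex.choose_spec
  have hcol : ∀ {a b c : ℕ} (A : Matrix (Fin a) (Fin b) F) (B : Matrix (Fin b) (Fin c) F) (j),
      A.mulVecLin (B.col j) = (A * B).col j := fun _ _ _ => rfl
  refine (Nat.card_le_card_of_injective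
    (β := (Fin l → κ) × {L // ∀ c, (S L).col c ∈ W})
    (fun z => (fun c => ⟨(z.1.1 - z₀ z.1.2).col c, ?_⟩, ⟨z.1.2, fun c => ?_⟩)) ?_).trans ?_
  · have h : Z z.1.2 z.1.1 := z.2
    have h' := hz₀ _ _ h
    refine Submodule.mem_inf.2 ⟨?_, ?_⟩
    · rw [LinearMap.mem_ker, hcol, Matrix.mul_sub, h.2, h'.2, sub_self]; rfl
    · rw [LinearMap.mem_ker, hcol, Matrix.mul_sub, h.1, h'.1, sub_self]; rfl
  · refine Submodule.mem_comap.2 (Submodule.mem_map.2 ⟨z.1.1.col c, ?_, ?_⟩)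
    · rw [LinearMap.mem_ker, hcol, z.2.1]; rfl
    · rw [hcol, hcol, z.2.2]
  · rintro ⟨⟨z, L⟩, hz⟩ ⟨⟨z', L'⟩, hz'⟩ h
    simp only [Prod.mk.injEq, Subtype.mk.injEq] at h
    obtain ⟨ha, rfl⟩ := h
    have : z = z' := by
      ext i c
      have := congrFun (congrArg Subtype.val (congrFun ha c)) i
      simpa using this
    subst this
    rfl
  · rw [Nat.card_prod, card_columns_mem]
    refine (Nat.mul_le_mul_left _ (card_encoder_columns_mem_le S hS (by omega) W)).trans ?_
    rw [← pow_add, ← add_mul]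
    exact Nat.pow_le_pow_right Fintype.card_pos (Nat.mul_le_mul_right l hdim)

/-- Two offsets `x`, `x'` of the linear code `S` are confusable if some codewords of the respective
cosets yield the same observation through `G` (shifted by `D`) and `G'`, while the first one
shows `w` through `E`. -/
def Confusable {p : ℕ} (g : ℕ) (E : Matrix (Fin r) (Fin m) F) (w : Matrix (Fin r) (Fin l) F)
    (D : Matrix (Fin p) (Fin l) F) (G G' : Matrix (Fin p) (Fin m) F)
    (x x' : Matrix (Fin m) (Fin l) F) : Prop :=
  E.rank = r ∧ g ≤ G.rank ∧ g ≤ G'.rank ∧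
    ∃ L L', E * (x + S L) = w ∧ G * (x + S L) + D = G' * (x' + S L')

theorem card_confusable_le {p g : ℕ}
    (hS : ∀ E : Matrix (Fin r) (Fin m) F, E.rank = r → Function.Bijective (fun L => E * S L))
    (E : Matrix (Fin r) (Fin m) F) (w : Matrix (Fin r) (Fin l) F)
    (D : Matrix (Fin p) (Fin l) F) (G G' : Matrix (Fin p) (Fin m) F)
    (x' : Matrix (Fin m) (Fin l) F) :
    Nat.card {x // Confusable S g E w D G G' x x'} ≤
      Fintype.card F ^ (r * l) * Fintype.card F ^ ((m - g) * l) := by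
  classical
  rcases isEmpty_or_nonempty {x // Confusable S g E w D G G' x x'} with h | ⟨⟨x₀, h₀⟩⟩
  · rw [Nat.card_of_isEmpty]
    exact Nat.zero_le _
  obtain ⟨hE, hG, hG', L₀, L₀', h1, h2⟩ := h₀
  refine le_trans ?_ (Nat.mul_le_mul_left _ (card_homogeneous_solutions_le S hS E G G' hE hG hG'))
  rw [← card_matrix, ← Nat.card_prod]
  choose L L' hL using fun x : {x // Confusable S g E w D G G' x x'} => x.2.2.2.2
  refine Nat.card_le_card_of_injective
    (fun x => (L x, ⟨(x.1 + S (L x) - (x₀ + S L₀), L' x - L₀'), ?_, ?_⟩)) ?_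
  · rw [Matrix.mul_sub, (hL x).1, h1, sub_self]
  · have h3 := (hL x).2
    rw [Matrix.mul_sub, eq_sub_of_add_eq h3, eq_sub_of_add_eq h2, map_sub, sub_sub_sub_cancel_right,
      ← Matrix.mul_sub]
    congr 1
    abel
  · intro x y h
    simp only [Prod.mk.injEq, Subtype.mk.injEq] at h
    obtain ⟨h3, h4, -⟩ := h
    rw [h3] at h4
    exact Subtype.ext (by simpa using h4)

end Counting

theorem exists_linear_mrd_encoder (F : Type) [Field F] [Fintype F] (r m l : ℕ) (hl : 0 < l)
    (hml : m ≤ l) :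
    ∃ S : Matrix (Fin r) (Fin l) F →ₗ[F] Matrix (Fin m) (Fin l) F,
      ∀ E : Matrix (Fin r) (Fin m) F, E.rank = r →
        Function.Bijective (fun L => E * S L) := by
  classical
  obtain ⟨p, hp⟩ := CharP.exists F
  have : Fact p.Prime := ⟨CharP.char_is_prime F p⟩
  have : NeZero l := ⟨hl.ne'⟩
  let K := FiniteField.Extension F p l
  have hK : Module.finrank F K = l := FiniteField.finrank_extension F p l
  let b : Module.Basis (Fin l) F K := Module.finBasisOfFinrankEq F K hK
  let e : K ≃ₗ[F] (Fin l → F) := b.equivFun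
  let φ : K →ₗ[F] K := (FiniteField.frobeniusAlgHom F K).toLinearMap
  have hφ : ∀ (j : ℕ) (x : K), (φ ^ j) x = x ^ (Fintype.card F ^ j) := by
    intro j
    induction j with
    | zero => intro x; simp
    | succ j ih =>
      intro x
      rw [pow_succ', Module.End.mul_apply, ih]
      change (x ^ Fintype.card F ^ j) ^ Fintype.card F = _
      rw [← pow_mul, pow_succ]
  let P : Matrix (Fin r) (Fin l) F → K →ₗ[F] K :=
    fun L => ∑ j : Fin r, LinearMap.mulLeft F (e.symm (L j)) ∘ₗ (φ ^ (j : ℕ))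
  have hP : ∀ L x, P L x = ∑ j : Fin r, e.symm (L j) * x ^ (Fintype.card F ^ (j : ℕ)) := by
    intro L x
    simp [P, hφ]
  let a : Fin m → K := fun i => b (Fin.castLE hml i)
  have ha : LinearIndependent F a := b.linearIndependent.comp _ (Fin.castLE_injective hml)
  let S : Matrix (Fin r) (Fin l) F →ₗ[F] Matrix (Fin m) (Fin l) F :=
    { toFun := fun L => Matrix.of fun i => e (P L (a i))
      map_add' := by
        intro L L'
        ext i c
        have : P (L + L') (a i) = P L (a i) + P L' (a i) := by
          simp only [hP, ← Finset.sum_add_distrib, ← add_mul, ← map_add]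
          rfl
        simp [this]
      map_smul' := by
        intro t L
        ext i c
        have : P (t • L) (a i) = t • P L (a i) := by
          simp only [hP, Finset.smul_sum, ← smul_mul_assoc, ← map_smul]
          rfl
        simp [this] }
  have hS : ∀ L i, S L i = e (P L (a i)) := fun _ _ => rfl
  refine ⟨S, fun E hE => ?_⟩
  refine (Finite.injective_iff_bijective (α := Matrix (Fin r) (Fin l) F)).1 ?_
  suffices H : ∀ L, E * S L = 0 → L = 0 by
    intro L L' h
    have := H (L - L') (by simp only [map_sub, Matrix.mul_sub, sub_eq_zero]; exact h)
    exact sub_eq_zero.1 this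
  intro L hL
  have hrow : LinearIndependent F E.row := by
    rw [linearIndependent_iff_card_eq_finrank_span]
    rw [Set.finrank, ← Matrix.rank_eq_finrank_span_row, hE, Fintype.card_fin]
  let v : (Fin r → F) → K := fun c => ∑ i, (Matrix.vecMul c E) i • a i
  have hv : Function.Injective v := by
    intro c c' h
    have h1 : Matrix.vecMul c E = Matrix.vecMul c' E := by
      have := ha.fintypeLinearCombination_injective
      apply this
      simpa [Fintype.linearCombination_apply] using h
    exact (Matrix.vecMul_injective_iff.2 hrow) h1
  have hPv : ∀ c, P L (v c) = 0 := by
    intro c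
    apply e.injective
    have h2 : e (P L (v c)) = Matrix.vecMul c (E * S L) := by
      rw [← Matrix.vecMul_vecMul, Matrix.vecMul_eq_sum]
      simp only [v, map_sum, map_smul]
      rfl
    rw [h2, hL, map_zero, Matrix.vecMul_zero]
  let Q : Polynomial K :=
    ∑ j : Fin r, Polynomial.C (e.symm (L j)) * Polynomial.X ^ (Fintype.card F ^ (j : ℕ))
  have hq : 1 < Fintype.card F := Fintype.one_lt_card
  have hQ : Q = 0 := by
    apply Polynomial.eq_zero_of_natDegree_lt_card_of_eval_eq_zero Q hv
    · intro c
      have := hPv c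
      rw [hP] at this
      simpa [Q, Polynomial.eval_finsetSum] using this
    · rw [Fintype.card_fun, Fintype.card_fin]
      rcases Nat.eq_zero_or_pos r with h0 | h0
      · subst h0; simp [Q]
      refine lt_of_le_of_lt (Polynomial.natDegree_sum_le_of_forall_le
        (n := Fintype.card F ^ (r - 1)) _ _ ?_) (Nat.pow_lt_pow_right hq (by omega))
      intro j _
      exact (Polynomial.natDegree_C_mul_X_pow_le _ _).trans
        (Nat.pow_le_pow_right (by omega) (by omega))
  ext j c
  have h3 : Q.coeff (Fintype.card F ^ (j : ℕ)) = e.symm (L j) := by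
    simp only [Q, Polynomial.finsetSum_coeff, Polynomial.coeff_C_mul, Polynomial.coeff_X_pow]
    rw [Finset.sum_eq_single j]
    · simp
    · intro i _ hij
      rw [if_neg, mul_zero]
      intro h
      exact hij (Fin.ext (Nat.pow_right_injective hq h).symm)
    · simp
  rw [hQ, Polynomial.coeff_zero] at h3
  have h4 : L j = 0 := by
    apply e.symm.injective
    rw [← h3, map_zero]
  rw [h4]; rfl

theorem card_forced_mul_pow_le {X M : Type*} [Fintype X] [Fintype M] [Nonempty X]
    (ρ : M → ℤ) (R : X → X → Prop) (Q : ℕ)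
    (hR : ∀ x', Fintype.card M * Nat.card {x // R x x'} * Q ≤ Fintype.card X) (T : Finset M) :
    Nat.card {f : M → X // ∀ m ∈ T, ∃ m', ρ m' < ρ m ∧ R (f m) (f m')} * Q ^ T.card
      ≤ Fintype.card X ^ Fintype.card M := by
  classical
  induction T using Finset.induction_on_max_value ρ with
  | empty => simp
  | insert a T haT hmax ih =>
    rw [Nat.subtype_card (Finset.univ.filter
      (fun f : M → X => ∀ m ∈ T, ∃ m', ρ m' < ρ m ∧ R (f m) (f m'))) (by simp)] at ih
    rw [Nat.subtype_card (Finset.univ.filter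
      (fun f : M → X => ∀ m ∈ insert a T, ∃ m', ρ m' < ρ m ∧ R (f m) (f m'))) (by simp)]
    set A' := Finset.univ.filter
      (fun f : M → X => ∀ m ∈ T, ∃ m', ρ m' < ρ m ∧ R (f m) (f m'))
    set A := Finset.univ.filter
      (fun f : M → X => ∀ m ∈ insert a T, ∃ m', ρ m' < ρ m ∧ R (f m) (f m'))
    let B : (M → X) → Finset X :=
      fun h => Finset.univ.filter (fun y => ∃ m', ρ m' < ρ a ∧ R y (h m'))
    have hB : ∀ h, (B h).card * Q ≤ Fintype.card X := by
      intro h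
      have h1 : (B h).card ≤ ∑ m' : M, Nat.card {x // R x (h m')} := by
        refine (Finset.card_le_card (t := Finset.univ.biUnion
          (fun m' => Finset.univ.filter (fun x => R x (h m')))) ?_).trans
          (Finset.card_biUnion_le.trans (le_of_eq ?_))
        · intro y hy
          obtain ⟨m', -, hm'⟩ := (Finset.mem_filter.1 hy).2
          simpa using ⟨m', hm'⟩
        · refine Finset.sum_congr rfl fun m' _ => ?_
          rw [Nat.subtype_card (Finset.univ.filter (fun x => R x (h m'))) (by simp)]
      have hM : 0 < Fintype.card M := Fintype.card_pos_iff.2 ⟨a⟩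
      refine Nat.le_of_mul_le_mul_left ?_ hM
      calc Fintype.card M * ((B h).card * Q)
          ≤ Fintype.card M * ((∑ m' : M, Nat.card {x // R x (h m')}) * Q) := by gcongr
        _ = ∑ m' : M, Fintype.card M * Nat.card {x // R x (h m')} * Q := by
            rw [Finset.sum_mul, Finset.mul_sum]
            exact Finset.sum_congr rfl fun _ _ => by ring
        _ ≤ ∑ _m' : M, Fintype.card X := Finset.sum_le_sum fun m' _ => hR _
        _ = Fintype.card M * Fintype.card X := by simp
    have key : A.card * Fintype.card X ≤ ∑ h ∈ A', (B h).card := by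
      rw [← Finset.card_sigma, ← Finset.card_univ, ← Finset.card_product]
      refine Finset.card_le_card_of_injOn
        (fun z => ⟨Function.update z.1 a z.2, z.1 a⟩) ?_ ?_
      · rintro ⟨f, x⟩ hf
        have hf' : ∀ m ∈ insert a T, ∃ m', ρ m' < ρ m ∧ R (f m) (f m') := by
          simpa [A] using hf
        simp only [Finset.coe_sigma, Set.mem_sigma_iff, Finset.mem_coe]
        constructor
        · simp only [A', Finset.mem_filter, Finset.mem_univ, true_and]
          intro m hm
          have hma : m ≠ a := fun h => haT (h ▸ hm)
          obtain ⟨m', h1, h2⟩ := hf' m (Finset.mem_insert_of_mem hm)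
          have hm'a : m' ≠ a := by
            rintro rfl
            exact absurd (hmax m hm) (by omega)
          exact ⟨m', h1, by simpa [hma, hm'a] using h2⟩
        · obtain ⟨m', h1, h2⟩ := hf' a (Finset.mem_insert_self _ _)
          have hm'a : m' ≠ a := by
            rintro rfl
            omega
          simp only [B, Finset.mem_filter, Finset.mem_univ, true_and]
          exact ⟨m', h1, by simpa [hm'a] using h2⟩
      · rintro ⟨f, x⟩ - ⟨f', x'⟩ - h
        simp only [Sigma.mk.injEq, heq_eq_eq] at h
        obtain ⟨h1, h2⟩ := h
        have hx : x = x' := by simpa using congrFun h1 a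
        have hff : f = f' := by
          funext m
          by_cases hm : m = a
          · rw [hm, h2]
          · simpa [hm] using congrFun h1 m
        rw [hx, hff]
    have hA : A.card * Q ≤ A'.card := by
      refine Nat.le_of_mul_le_mul_right ?_ (Fintype.card_pos (α := X))
      calc A.card * Q * Fintype.card X = A.card * Fintype.card X * Q := by ring
        _ ≤ (∑ h ∈ A', (B h).card) * Q := by gcongr
        _ = ∑ h ∈ A', (B h).card * Q := Finset.sum_mul _ _ _
        _ ≤ ∑ _h ∈ A', Fintype.card X := Finset.sum_le_sum fun h _ => hB h
        _ = A'.card * Fintype.card X := by simp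
    rw [Finset.card_insert_of_notMem haT, pow_succ]
    calc A.card * (Q ^ T.card * Q) = A.card * Q * Q ^ T.card := by ring
      _ ≤ A'.card * Q ^ T.card := by gcongr
      _ ≤ _ := ih

theorem exists_function_few_conflicts {X M Θ : Type*} [Fintype X] [Fintype M] [Fintype Θ]
    [Nonempty X] (R : Θ → X → X → Prop) (Q s : ℕ)
    (hR : ∀ θ x', Fintype.card M * Nat.card {x // R θ x x'} * Q ≤ Fintype.card X)
    (hlarge : Fintype.card Θ * 2 * 2 ^ Fintype.card M < Q ^ s) :
    ∃ f : M → X, ∀ θ, Nat.card {m // ∃ m', m' ≠ m ∧ R θ (f m) (f m')} < 2 * s := by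
  classical
  by_contra! hcon
  let ρ : Bool → M → ℤ := fun b m =>
    if b then ((Fintype.equivFin M m : ℕ) : ℤ) else -((Fintype.equivFin M m : ℕ) : ℤ)
  have hρ : ∀ b, Function.Injective (ρ b) := by
    intro b m m' h
    apply (Fintype.equivFin M).injective
    apply Fin.ext
    cases b <;> simp [ρ] at h <;> omega
  let A : Θ × Bool × Finset M → Finset (M → X) := fun z =>
    Finset.univ.filter (fun f => ∀ m ∈ z.2.2, ∃ m', ρ z.2.1 m' < ρ z.2.1 m ∧ R z.1 (f m) (f m'))
  have hA : ∀ z, (A z).card * Q ^ z.2.2.card ≤ Fintype.card X ^ Fintype.card M := by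
    intro z
    have := card_forced_mul_pow_le (ρ z.2.1) (R z.1) Q (hR z.1) z.2.2
    rwa [Nat.subtype_card (A z) (by simp [A])] at this
  let I : Finset (Θ × Bool × Finset M) := Finset.univ.filter (fun z => z.2.2.card = s)
  have hI : I.card ≤ Fintype.card Θ * 2 * 2 ^ Fintype.card M := by
    refine (Finset.card_filter_le _ _).trans (le_of_eq ?_)
    simp [Fintype.card_prod, mul_assoc]
  have hcover : (Finset.univ : Finset (M → X)) ⊆ I.biUnion A := by
    intro f _
    obtain ⟨θ, hθ⟩ := hcon f
    rw [Nat.subtype_card (Finset.univ.filter (fun m => ∃ m', m' ≠ m ∧ R θ (f m) (f m')))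
      (by simp)] at hθ
    let U : Bool → Finset M := fun b =>
      Finset.univ.filter (fun m => ∃ m', ρ b m' < ρ b m ∧ R θ (f m) (f m'))
    have hU : Finset.univ.filter (fun m => ∃ m', m' ≠ m ∧ R θ (f m) (f m')) ⊆
        U true ∪ U false := by
      intro m hm
      obtain ⟨m', h1, h2⟩ := (Finset.mem_filter.1 hm).2
      have h3 : ρ true m' ≠ ρ true m := fun h => h1 (hρ _ h)
      rcases lt_or_gt_of_ne h3 with h | h
      · exact Finset.mem_union_left _ (by simpa [U] using ⟨m', h, h2⟩)
      · refine Finset.mem_union_right _ ?_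
        simp only [U, Finset.mem_filter, Finset.mem_univ, true_and]
        exact ⟨m', by simp [ρ] at h ⊢; exact h, h2⟩
    have hU' := (Finset.card_le_card hU).trans (Finset.card_union_le _ _)
    have : ∃ b, s ≤ (U b).card := by
      by_contra! hb
      have h1 := hb true
      have h2 := hb false
      omega
    obtain ⟨b, hb⟩ := this
    obtain ⟨T, hT, hTs⟩ := Finset.exists_subset_card_eq hb
    refine Finset.mem_biUnion.2 ⟨(θ, b, T), by simp [I, hTs], ?_⟩
    simp only [A, Finset.mem_filter, Finset.mem_univ, true_and]
    intro m hm
    exact (Finset.mem_filter.1 (hT hm)).2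
  have hX : 0 < Fintype.card X ^ Fintype.card M := pow_pos Fintype.card_pos _
  have hcount : Fintype.card X ^ Fintype.card M ≤ ∑ z ∈ I, (A z).card := by
    rw [← Fintype.card_fun, ← Finset.card_univ]
    exact (Finset.card_le_card hcover).trans Finset.card_biUnion_le
  have : Fintype.card X ^ Fintype.card M * Q ^ s <
      Fintype.card X ^ Fintype.card M * Q ^ s := by
    calc _ ≤ (∑ z ∈ I, (A z).card) * Q ^ s := by gcongr
      _ = ∑ z ∈ I, (A z).card * Q ^ s := Finset.sum_mul _ _ _
      _ ≤ ∑ _z ∈ I, Fintype.card X ^ Fintype.card M := by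
          refine Finset.sum_le_sum fun z hz => ?_
          rw [← (Finset.mem_filter.1 hz).2]
          exact hA z
      _ = Fintype.card X ^ Fintype.card M * I.card := by simp [mul_comm]
      _ ≤ Fintype.card X ^ Fintype.card M * (Fintype.card Θ * 2 * 2 ^ Fintype.card M) := by gcongr
      _ < _ := by gcongr
  exact lt_irrefl _ this

theorem exists_encoder_few_conflicts (F : Type) [Field F] [Fintype F] (r m p g : ℕ)
    (hrg : r < g) :
    ∃ N₀ : ℕ, 5 ≤ N₀ ∧ ∀ N, N₀ ≤ N →
      ∃ (S : Matrix (Fin r) (Fin (N ^ 2)) F →ₗ[F] Matrix (Fin m) (Fin (N ^ 2)) F)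
        (f : (Fin ((g - r) * N ^ 2 - N) → F) → Matrix (Fin m) (Fin (N ^ 2)) F),
        (∀ E : Matrix (Fin r) (Fin m) F, E.rank = r → Function.Bijective (fun L => E * S L)) ∧
        ∀ (E : Matrix (Fin r) (Fin m) F) (w : Matrix (Fin r) (Fin (N ^ 2)) F)
          (D : Matrix (Fin p) (Fin (N ^ 2)) F) (G G' : Matrix (Fin p) (Fin m) F),
          Nat.card {a // ∃ a', a' ≠ a ∧ Confusable S g E w D G G' (f a) (f a')} * N ≤
            6 * Fintype.card F ^ ((g - r) * N ^ 2 - N) := by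
  classical
  set C := r * m + r + p + 2 * (p * m) with hC
  refine ⟨C + m + 5, by omega, fun N hN => ?_⟩
  have hNsq : N ≤ N ^ 2 := Nat.le_self_pow (by norm_num) N
  obtain ⟨S, hS⟩ := exists_linear_mrd_encoder F r m (N ^ 2) (pow_pos (by omega) 2) (by omega)
  have hq : 2 ≤ Fintype.card F := Fintype.one_lt_card
  set k := (g - r) * N ^ 2 - N with hk
  have hmul : N ^ 2 ≤ (g - r) * N ^ 2 := Nat.le_mul_of_pos_left _ (by omega)
  have hkN : k + N = (g - r) * N ^ 2 := by omega
  have hk4 : N * 4 ≤ k := by nlinarith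
  have hK : (N + 1) ^ 4 ≤ Fintype.card F ^ k := by
    calc (N + 1) ^ 4 ≤ (2 ^ N) ^ 4 := Nat.pow_le_pow_left Nat.lt_two_pow_self 4
      _ = 2 ^ (N * 4) := by rw [← pow_mul]
      _ ≤ 2 ^ k := Nat.pow_le_pow_right (by norm_num) hk4
      _ ≤ _ := Nat.pow_le_pow_left hq k
  have hCK : C * N ^ 2 + 1 ≤ Fintype.card F ^ k := by
    refine le_trans ?_ hK
    calc C * N ^ 2 + 1 ≤ N * N ^ 2 + 1 := by gcongr; omega
      _ ≤ (N + 1) ^ 4 := by ring_nf; omega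
  have hNK : N ≤ Fintype.card F ^ k := le_trans (by ring_nf; omega) hK
  let Θ := Matrix (Fin r) (Fin m) F × Matrix (Fin r) (Fin (N ^ 2)) F ×
    Matrix (Fin p) (Fin (N ^ 2)) F × Matrix (Fin p) (Fin m) F × Matrix (Fin p) (Fin m) F
  have hΘ : Fintype.card Θ ≤ Fintype.card F ^ (C * N ^ 2) := by
    rw [← Nat.card_eq_fintype_card]
    simp only [Θ, Nat.card_prod, card_matrix, ← pow_add]
    refine Nat.pow_le_pow_right (by omega) ?_
    have h1 : 1 ≤ N ^ 2 := Nat.one_le_pow _ _ (by omega)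
    calc r * m + (r * N ^ 2 + (p * N ^ 2 + (p * m + p * m)))
        = (r * m + 2 * (p * m)) * 1 + (r + p) * N ^ 2 := by ring
      _ ≤ (r * m + 2 * (p * m)) * N ^ 2 + (r + p) * N ^ 2 := by gcongr
      _ = C * N ^ 2 := by rw [hC]; ring
  set K := Fintype.card F ^ k with hKdef
  have hR : ∀ (θ : Θ) (x' : Matrix (Fin m) (Fin (N ^ 2)) F),
      Fintype.card (Fin k → F) *
        Nat.card {x // Confusable S g θ.1 θ.2.1 θ.2.2.1 θ.2.2.2.1 θ.2.2.2.2 x x'} *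
        Fintype.card F ^ N ≤ Fintype.card (Matrix (Fin m) (Fin (N ^ 2)) F) := by
    rintro ⟨E, w, D, G, G'⟩ x'
    by_cases hrank : g ≤ G.rank
    · have hgm : g ≤ m := hrank.trans (by simpa using G.rank_le_width)
      have hX : Fintype.card (Matrix (Fin m) (Fin (N ^ 2)) F) =
          Fintype.card F ^ (m * N ^ 2) := by
        rw [← card_matrix, Nat.card_eq_fintype_card]
      rw [hX, Fintype.card_fun, Fintype.card_fin]
      calc _ ≤ Fintype.card F ^ k * (Fintype.card F ^ (r * N ^ 2) *
            Fintype.card F ^ ((m - g) * N ^ 2)) * Fintype.card F ^ N := by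
            gcongr
            exact card_confusable_le S hS E w D G G' x'
        _ = Fintype.card F ^ ((k + N) + (r + (m - g)) * N ^ 2) := by
            simp only [← pow_add]
            congr 1
            ring
        _ = Fintype.card F ^ (m * N ^ 2) := by
            rw [hkN, ← add_mul]
            congr 2
            omega
    · have : IsEmpty {x // Confusable S g E w D G G' x x'} := ⟨fun x => hrank x.2.2.1⟩
      rw [Nat.card_of_isEmpty, mul_zero, zero_mul]
      exact Nat.zero_le _
  have hlarge : Fintype.card Θ * 2 * 2 ^ Fintype.card (Fin k → F) <
      (Fintype.card F ^ N) ^ (2 * K / N + 1) := by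
    rw [Fintype.card_fun, Fintype.card_fin, ← pow_mul]
    calc Fintype.card Θ * 2 * 2 ^ K
        ≤ Fintype.card F ^ (C * N ^ 2) * Fintype.card F * Fintype.card F ^ K := by gcongr
      _ = Fintype.card F ^ (C * N ^ 2 + 1 + K) := by ring
      _ < Fintype.card F ^ (N * (2 * K / N + 1)) := by
          refine Nat.pow_lt_pow_right (by omega) ?_
          have := Nat.lt_mul_div_succ (2 * K) (show 0 < N by omega)
          omega
  obtain ⟨f, hf⟩ := exists_function_few_conflicts (M := Fin k → F)
    (X := Matrix (Fin m) (Fin (N ^ 2)) F) (Θ := Θ)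
    (fun θ => Confusable S g θ.1 θ.2.1 θ.2.2.1 θ.2.2.2.1 θ.2.2.2.2)
    (Fintype.card F ^ N) (2 * K / N + 1) hR hlarge
  refine ⟨S, f, hS, fun E w D G G' => ?_⟩
  have h1 := hf (E, w, D, G, G')
  have h2 : 2 * K / N * N ≤ 2 * K := Nat.div_mul_le_self _ _
  calc _ ≤ (2 * (2 * K / N) + 2) * N := Nat.mul_le_mul_right _ (by simp only at h1; omega)
    _ = 2 * (2 * K / N * N) + 2 * N := by ring
    _ ≤ 6 * K := by omega

theorem sum_prU_eq_one {Ω A : Type*} [Fintype Ω] [Nonempty Ω] [Fintype A] (X : Ω → A) :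
    ∑ a : A, prU (fun ω => X ω = a) = 1 := by
  have h : ∑ a : A, Nat.card {ω // X ω = a} = Fintype.card Ω := by
    rw [← Nat.card_sigma, Nat.card_congr (Equiv.sigmaFiberEquiv X), Nat.card_eq_fintype_card]
  have hΩ : (Fintype.card Ω : ℝ) ≠ 0 := by exact_mod_cast Fintype.card_ne_zero
  simp only [prU]
  rw [← Finset.sum_div, div_eq_one_iff_eq hΩ, ← h]
  push_cast
  rfl

theorem entU_eq_sum_negMulLog {Ω A : Type*} [Fintype Ω] [Fintype A] (X : Ω → A) :
    entU X = ∑ a : A, Real.negMulLog (prU (fun ω => X ω = a)) := by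
  simp [entU, Real.negMulLog]

theorem miU_eq_zero_of_prU_mul {Ω A B : Type*} [Fintype Ω] [Nonempty Ω] [Fintype A] [Fintype B]
    (X : Ω → A) (Y : Ω → B)
    (h : ∀ a b, prU (fun ω => (X ω, Y ω) = (a, b)) =
      prU (fun ω => X ω = a) * prU (fun ω => Y ω = b)) :
    miU X Y = 0 := by
  have hpair : entU (fun ω => (X ω, Y ω)) = entU X + entU Y := by
    simp only [entU_eq_sum_negMulLog, Fintype.sum_prod_type, h, Real.negMulLog_mul,
      Finset.sum_add_distrib]
    congr 1
    · simp_rw [← Finset.sum_mul, sum_prU_eq_one Y, one_mul]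
    · simp_rw [← Finset.mul_sum, ← Finset.sum_mul, sum_prU_eq_one X, one_mul]
  rw [miU, hpair, sub_self]

theorem miU_fst_eq_zero {A J B : Type*} [Fintype A] [Fintype J] [Fintype B] [Nonempty A]
    [Nonempty J] (Y : A × J → B) (c : B → ℕ) (h : ∀ a b, Nat.card {j // Y (a, j) = b} = c b) :
    miU (fun ω : A × J => ω.1) Y = 0 := by
  apply miU_eq_zero_of_prU_mul
  intro a b
  have h1 : Nat.card {ω : A × J // (ω.1, Y ω) = (a, b)} = c b := by
    rw [← h a b]
    refine Nat.card_congr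
      { toFun := fun ω => ⟨ω.1.2, ?_⟩
        invFun := fun j => ⟨(a, j.1), by rw [j.2]⟩
        left_inv := ?_
        right_inv := fun _ => rfl }
    · obtain ⟨⟨a', j⟩, hω⟩ := ω
      obtain ⟨rfl, hY⟩ := Prod.mk.inj hω
      exact hY
    · rintro ⟨⟨a', j⟩, hω⟩
      simp only [Prod.mk.injEq] at hω
      simp [hω.1]
  have h2 : Nat.card {ω : A × J // ω.1 = a} = Fintype.card J := by
    rw [← Nat.card_eq_fintype_card]
    refine Nat.card_congr
      { toFun := fun ω => ω.1.2
        invFun := fun j => ⟨(a, j), rfl⟩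
        left_inv := ?_
        right_inv := fun _ => rfl }
    rintro ⟨⟨a', j⟩, rfl⟩
    rfl
  have h3 : Nat.card {ω : A × J // Y ω = b} = Fintype.card A * c b := by
    have e : {ω : A × J // Y ω = b} ≃ Σ a, {j // Y (a, j) = b} :=
      { toFun := fun ω => ⟨ω.1.1, ω.1.2, ω.2⟩
        invFun := fun z => ⟨(z.1, z.2.1), z.2.2⟩
        left_inv := fun _ => rfl
        right_inv := fun _ => rfl }
    rw [Nat.card_congr e, Nat.card_sigma]
    simp [h]
  have hA : (Fintype.card A : ℝ) ≠ 0 := by exact_mod_cast Fintype.card_ne_zero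
  have hJ : (Fintype.card J : ℝ) ≠ 0 := by exact_mod_cast Fintype.card_ne_zero
  simp only [prU]
  rw [h1, h2, h3, Fintype.card_prod]
  push_cast
  field_simp

section Attack

variable {F : Type} [Field F] {A J : Type} {m l m5 m6 : ℕ}

theorem attack_eq_iff {KE : Matrix (Fin m6) (Fin m) F} {HE : Matrix (Fin m6) (Fin m5) F}
    {α : Matrix (Fin m6) (Fin l) F → Matrix (Fin m5) (Fin l) F}
    (hα : ∀ x : Matrix (Fin m) (Fin l) F, ∃! y, y = KE * x + HE * α y)
    {x : Matrix (Fin m) (Fin l) F} {y y' : Matrix (Fin m6) (Fin l) F}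
    (hy : y = KE * x + HE * α y) : y = y' ↔ KE * x = y' - HE * α y' := by
  constructor
  · rintro rfl
    exact eq_sub_of_add_eq hy.symm
  · intro h
    exact (hα x).unique hy (sub_eq_iff_eq_add.1 h.symm)

theorem miU_attack_eq_zero [Fintype F] [Fintype A] [Fintype J] [Nonempty A] [Nonempty J] {r : ℕ}
    (f : A → Matrix (Fin m) (Fin l) F) (S : J → Matrix (Fin m) (Fin l) F)
    (hS : ∀ E : Matrix (Fin r) (Fin m) F, E.rank = r → Function.Bijective (fun j => E * S j))
    (KE : Matrix (Fin m6) (Fin m) F) (HE : Matrix (Fin m6) (Fin m5) F) (hKE : KE.rank = r)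
    (α : Matrix (Fin m6) (Fin l) F → Matrix (Fin m5) (Fin l) F)
    (hα : ∀ x : Matrix (Fin m) (Fin l) F, ∃! y, y = KE * x + HE * α y)
    (YE : A × J → Matrix (Fin m6) (Fin l) F)
    (hYE : ∀ ω, YE ω = KE * (f ω.1 + S ω.2) + HE * α (YE ω)) :
    miU (fun ω : A × J => ω.1) YE = 0 := by
  obtain ⟨C, E, hE, hCE⟩ := KE.exists_rank_factorization
  subst hKE
  refine miU_fst_eq_zero YE
    (fun y => Nat.card {w : Matrix (Fin KE.rank) (Fin l) F // C * w = y - HE * α y}) ?_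
  intro a y
  have hbij : Function.Bijective (fun j => E * (f a + S j)) := by
    have : (fun j => E * (f a + S j)) = (Equiv.addLeft (E * f a)) ∘ (fun j => E * S j) := by
      funext j
      simp [Matrix.mul_add]
    rw [this]
    exact (Equiv.bijective _).comp (hS E hE)
  refine Nat.card_congr ((Equiv.ofBijective _ hbij).subtypeEquiv fun j => ?_)
  rw [attack_eq_iff hα (hYE (a, j)), Equiv.ofBijective_apply, ← Matrix.mul_assoc, ← hCE]

theorem exists_consistent_decoder [Nonempty A] {m0 m1 m4 : ℕ}
    (x : A → J → Matrix (Fin m) (Fin l) F) :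
    ∃ dec : Matrix (Fin m4) (Fin l) F → A, ∀ Y,
      (∃ a j, ∃ K : Matrix (Fin m4) (Fin m) F, K.rank = m0 ∧ (Y - K * x a j).rank ≤ m1) →
      ∃ j, ∃ K : Matrix (Fin m4) (Fin m) F, K.rank = m0 ∧ (Y - K * x (dec Y) j).rank ≤ m1 := by
  classical
  refine ⟨fun Y => if h : ∃ a j, ∃ K : Matrix (Fin m4) (Fin m) F,
    K.rank = m0 ∧ (Y - K * x a j).rank ≤ m1 then h.choose else Classical.arbitrary A, ?_⟩
  intro Y h
  simp only [dif_pos h]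
  exact h.choose_spec

end Attack

theorem card_decoding_error_le {F : Type} [Field F] [Fintype F] {A J : Type} [Finite A]
    {m l m4 m5 m6 m0 m1 r b : ℕ}
    (S : Matrix (Fin r) (Fin l) F →ₗ[F] Matrix (Fin m) (Fin l) F)
    (hS : ∀ E : Matrix (Fin r) (Fin m) F, E.rank = r → Function.Bijective (fun L => E * S L))
    (e : J ≃ Matrix (Fin r) (Fin l) F) (f : A → Matrix (Fin m) (Fin l) F)
    (hb : ∀ (E : Matrix (Fin r) (Fin m) F) (w : Matrix (Fin r) (Fin l) F)
      (D : Matrix (Fin m4) (Fin l) F) (G G' : Matrix (Fin m4) (Fin m) F),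
      Nat.card {a // ∃ a', a' ≠ a ∧ Confusable S (m0 - m1) E w D G G' (f a) (f a')} ≤ b)
    (dec : Matrix (Fin m4) (Fin l) F → A)
    (hdec : ∀ Y, (∃ a j, ∃ K : Matrix (Fin m4) (Fin m) F,
        K.rank = m0 ∧ (Y - K * (f a + S (e j))).rank ≤ m1) →
      ∃ j, ∃ K : Matrix (Fin m4) (Fin m) F,
        K.rank = m0 ∧ (Y - K * (f (dec Y) + S (e j))).rank ≤ m1)
    (KB : Matrix (Fin m4) (Fin m) F) (HB : Matrix (Fin m4) (Fin m5) F)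
    (KE : Matrix (Fin m6) (Fin m) F) (HE : Matrix (Fin m6) (Fin m5) F)
    (hKB : KB.rank = m0) (hHB : HB.rank = m1) (hKE : KE.rank = r)
    (α : Matrix (Fin m6) (Fin l) F → Matrix (Fin m5) (Fin l) F)
    (hα : ∀ x : Matrix (Fin m) (Fin l) F, ∃! y, y = KE * x + HE * α y)
    (YE : A × J → Matrix (Fin m6) (Fin l) F)
    (hYE : ∀ ω, YE ω = KE * (f ω.1 + S (e ω.2)) + HE * α (YE ω)) :
    Nat.card {ω : A × J // dec (KB * (f ω.1 + S (e ω.2)) + HB * α (YE ω)) ≠ ω.1} ≤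
      Nat.card J * (Nat.card (Matrix (Fin m4) (Fin m4) F × Matrix (Fin m4) (Fin m) F) * b) := by
  classical
  obtain ⟨C, E, hE, hCE⟩ := KE.exists_rank_factorization
  subst hKE
  have hdep : ∀ ω ω' : A × J, E * (f ω.1 + S (e ω.2)) = E * (f ω'.1 + S (e ω'.2)) →
      YE ω = YE ω' := by
    intro ω ω' h
    have hKE : ∀ x : Matrix (Fin m) (Fin l) F, KE * x = C * (E * x) := fun x => by
      rw [← Matrix.mul_assoc, ← hCE]
    refine (hα (f ω.1 + S (e ω.2))).unique (hYE ω) ?_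
    rw [hKE, h, ← hKE]
    exact hYE ω'
  have hδ : ∀ w : Matrix (Fin KE.rank) (Fin l) F, ∃ d : Matrix (Fin m4) (Fin l) F,
      ∀ ω : A × J, E * (f ω.1 + S (e ω.2)) = w → HB * α (YE ω) = d := by
    intro w
    by_cases h : ∃ ω : A × J, E * (f ω.1 + S (e ω.2)) = w
    · obtain ⟨ω₀, h₀⟩ := h
      exact ⟨HB * α (YE ω₀), fun ω hω => by rw [hdep ω ω₀ (hω.trans h₀.symm)]⟩
    · exact ⟨0, fun ω hω => absurd ⟨ω, hω⟩ h⟩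
  choose δ hδ using hδ
  let I := Matrix (Fin KE.rank) (Fin l) F ×
    Matrix (Fin m4) (Fin m4) F × Matrix (Fin m4) (Fin m) F
  let B : I → Type := fun i => {a // ∃ a', a' ≠ a ∧ Confusable S (m0 - m1) E i.1
    (i.2.1 * δ i.1) (i.2.1 * KB) (i.2.1 * i.2.2) (f a) (f a')}
  have hkey : ∀ ω : {ω : A × J // dec (KB * (f ω.1 + S (e ω.2)) + HB * α (YE ω)) ≠ ω.1},
      ∃ p : Matrix (Fin m4) (Fin m4) F × Matrix (Fin m4) (Fin m) F,
        ∃ a', a' ≠ ω.1.1 ∧ Confusable S (m0 - m1) E (E * (f ω.1.1 + S (e ω.1.2)))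
          (p.1 * δ (E * (f ω.1.1 + S (e ω.1.2)))) (p.1 * KB) (p.1 * p.2) (f ω.1.1) (f a') := by
    rintro ⟨⟨a, j⟩, hω⟩
    simp only at hω ⊢
    set Y := KB * (f a + S (e j)) + HB * α (YE (a, j)) with hY
    obtain ⟨j', K', hK', hrank⟩ := hdec Y ⟨a, j, KB, hKB, by
      rw [hY, add_sub_cancel_left, ← hHB]
      exact Matrix.rank_mul_le_left _ _⟩
    obtain ⟨Q, hQ, hQr⟩ := Matrix.exists_annihilator _ hrank
    have hG := Matrix.rank_add_rank_le_rank_mul_add Q KB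
    have hG' := Matrix.rank_add_rank_le_rank_mul_add Q K'
    refine ⟨(Q, K'), dec Y, hω, hE, by simp only; omega, by simp only; omega,
      e j, e j', rfl, ?_⟩
    simp only
    rw [← hδ _ (a, j) rfl]
    rw [Matrix.mul_sub, sub_eq_zero] at hQ
    rw [Matrix.mul_assoc, Matrix.mul_assoc, ← hQ, hY, Matrix.mul_add Q]
  choose p hp using hkey
  let φ : {ω : A × J // dec (KB * (f ω.1 + S (e ω.2)) + HB * α (YE ω)) ≠ ω.1} →
      Σ i, B i := fun ω => ⟨(E * (f ω.1.1 + S (e ω.1.2)), p ω), ω.1.1, hp ω⟩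
  have hφ : Function.Injective φ := by
    have hproj : ∀ ω ω', φ ω = φ ω' → (φ ω).1.1 = (φ ω').1.1 ∧ ((φ ω).2 : A) = (φ ω').2 := by
      intro ω ω' h
      rw [h]
      exact ⟨rfl, rfl⟩
    rintro ⟨⟨a, j⟩, h⟩ ⟨⟨a', j'⟩, h'⟩ hh
    obtain ⟨h1, h2⟩ := hproj _ _ hh
    obtain rfl : a = a' := h2
    have h3 : E * (f a + S (e j)) = E * (f a + S (e j')) := h1
    rw [Matrix.mul_add, Matrix.mul_add] at h3
    have h4 := e.injective ((hS E hE).injective (add_left_cancel h3))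
    subst h4
    rfl
  refine (Nat.card_le_card_of_injective φ hφ).trans ?_
  rw [Nat.card_sigma]
  calc ∑ i, Nat.card (B i) ≤ ∑ _i : I, b := Finset.sum_le_sum fun i _ => hb _ _ _ _ _
    _ = Nat.card I * b := by
      rw [Finset.sum_const, smul_eq_mul, Finset.card_univ, Nat.card_eq_fintype_card]
    _ = _ := by
      rw [Nat.card_congr e, ← mul_assoc, ← Nat.card_prod]

/-- if `m2 + m1 < m0` there is a sequence of codes of block-length `l n` with
message set `F^(k n)` whose rate tends to `m0 - m1 - m2`, whose worst-case decoding error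
probability tends to `0` (robustness), and which for all sufficiently large `n` leaks no
information to Eve under any active attack satisfying the uniqueness condition (secrecy). -/
theorem exists_secure_robust_code_sequence
    (F : Type) [Field F] [Fintype F]
    (m0 m1 m2 m3 m4 : ℕ) (hm : m2 + m1 < m0) :
    ∃ (l k LL : ℕ → ℕ), (∀ n, 0 < l n) ∧ (∀ n, 0 < LL n) ∧
      ∃ (enc : ∀ n : ℕ, (Fin (k n) → F) → Fin (LL n) → Matrix (Fin m3) (Fin (l n)) F)
        (dec : ∀ n : ℕ, Matrix (Fin m4) (Fin (l n)) F → (Fin (k n) → F)),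
        Filter.Tendsto (fun n => (k n : ℝ) / (l n : ℝ)) Filter.atTop
          (nhds ((m0 : ℝ) - (m1 : ℝ) - (m2 : ℝ))) ∧
        (∀ ε : ℝ, 0 < ε → ∃ N : ℕ, ∀ n, N ≤ n →
          ∀ (m5 m6 : ℕ)
            (KB : Matrix (Fin m4) (Fin m3) F) (HB : Matrix (Fin m4) (Fin m5) F)
            (KE : Matrix (Fin m6) (Fin m3) F) (HE : Matrix (Fin m6) (Fin m5) F),
            KB.rank = m0 → HB.rank = m1 → KE.rank = m2 →
            ∀ (αn : Matrix (Fin m6) (Fin (l n)) F → Matrix (Fin m5) (Fin (l n)) F),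
              (∀ x : Matrix (Fin m3) (Fin (l n)) F,
                ∃! y : Matrix (Fin m6) (Fin (l n)) F, y = KE * x + HE * αn y) →
              ∀ (YE : (Fin (k n) → F) × Fin (LL n) → Matrix (Fin m6) (Fin (l n)) F),
                (∀ ω, YE ω = KE * enc n ω.1 ω.2 + HE * αn (YE ω)) →
                prU (fun ω : (Fin (k n) → F) × Fin (LL n) =>
                  dec n (KB * enc n ω.1 ω.2 + HB * αn (YE ω)) ≠ ω.1) ≤ ε) ∧
        (∃ N : ℕ, ∀ n, N ≤ n →
          ∀ (m5 m6 : ℕ)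
            (KB : Matrix (Fin m4) (Fin m3) F) (HB : Matrix (Fin m4) (Fin m5) F)
            (KE : Matrix (Fin m6) (Fin m3) F) (HE : Matrix (Fin m6) (Fin m5) F),
            KB.rank = m0 → HB.rank = m1 → KE.rank = m2 →
            ∀ (αn : Matrix (Fin m6) (Fin (l n)) F → Matrix (Fin m5) (Fin (l n)) F),
              (∀ x : Matrix (Fin m3) (Fin (l n)) F,
                ∃! y : Matrix (Fin m6) (Fin (l n)) F, y = KE * x + HE * αn y) →
              ∀ (YE : (Fin (k n) → F) × Fin (LL n) → Matrix (Fin m6) (Fin (l n)) F),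
                (∀ ω, YE ω = KE * enc n ω.1 ω.2 + HE * αn (YE ω)) →
                miU (fun ω : (Fin (k n) → F) × Fin (LL n) => ω.1) YE = 0) := by
  classical
  obtain ⟨N₀, hN₀, hcode⟩ := exists_encoder_few_conflicts F m2 m3 m4 (m0 - m1) (by omega)
  choose S f hS hb using fun n => hcode (n + N₀) (Nat.le_add_left _ _)
  let e : ∀ n, Fin (Fintype.card (Matrix (Fin m2) (Fin ((n + N₀) ^ 2)) F)) ≃
    Matrix (Fin m2) (Fin ((n + N₀) ^ 2)) F := fun n => (Fintype.equivFin _).symm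
  choose dec hdec using fun n => exists_consistent_decoder (m0 := m0) (m1 := m1) (m4 := m4)
    (fun a j => f n a + S n (e n j))
  refine ⟨fun n => (n + N₀) ^ 2, fun n => (m0 - m1 - m2) * (n + N₀) ^ 2 - (n + N₀),
    fun n => Fintype.card (Matrix (Fin m2) (Fin ((n + N₀) ^ 2)) F),
    fun n => pow_pos (by omega) 2, fun n => Fintype.card_pos,
    fun n a j => f n a + S n (e n j), dec, ?_, ?_, 0, ?_⟩
  · have hrate : ∀ n : ℕ, (((m0 - m1 - m2) * (n + N₀) ^ 2 - (n + N₀) : ℕ) : ℝ) /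
        (((n + N₀) ^ 2 : ℕ) : ℝ) = ((m0 : ℝ) - m1 - m2) - (((n + N₀ : ℕ) : ℝ))⁻¹ := by
      intro n
      have h1 : n + N₀ ≤ (m0 - m1 - m2) * (n + N₀) ^ 2 :=
        (Nat.le_self_pow (by norm_num) _).trans (Nat.le_mul_of_pos_left _ (by omega))
      have h2 : ((n + N₀ : ℕ) : ℝ) ≠ 0 := by
        exact_mod_cast (by omega : n + N₀ ≠ 0)
      rw [Nat.cast_sub h1, Nat.cast_mul, Nat.cast_pow, Nat.cast_sub (by omega),
        Nat.cast_sub (by omega)]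
      field_simp
    simp only [hrate]
    simpa using (tendsto_const_nhds (x := (m0 : ℝ) - m1 - m2)).sub
      ((tendsto_inv_atTop_nhds_zero_nat (𝕜 := ℝ)).comp (Filter.tendsto_add_atTop_nat N₀))
  · intro ε hε
    set c := Nat.card (Matrix (Fin m4) (Fin m4) F × Matrix (Fin m4) (Fin m3) F) with hc
    obtain ⟨N₁, hN₁⟩ := exists_nat_ge (6 * c / ε)
    refine ⟨N₁, fun n hn m5 m6 KB HB KE HE hKB hHB hKE α hα YE hYE => ?_⟩
    have hn0 : 0 < n + N₀ := by omega
    set K := Fintype.card F ^ ((m0 - m1 - m2) * (n + N₀) ^ 2 - (n + N₀)) with hK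
    have herr := card_decoding_error_le (b := 6 * K / (n + N₀)) (S n) (hS n) (e n) (f n)
      (fun E w D G G' => (Nat.le_div_iff_mul_le hn0).2 (hb n E w D G G')) (dec n) (hdec n)
      KB HB KE HE hKB hHB hKE α hα YE hYE
    rw [← hc, Nat.card_fin] at herr
    have hdiv : (6 * K / (n + N₀)) * (n + N₀) ≤ 6 * K := Nat.div_mul_le_self _ _
    set J := Fintype.card (Matrix (Fin m2) (Fin ((n + N₀) ^ 2)) F) with hJ
    have hJ0 : 0 < J := Fintype.card_pos
    have hK0 : 0 < K := pow_pos Fintype.card_pos _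
    have hε' : (6 * c : ℝ) ≤ ε * ((n + N₀ : ℕ) : ℝ) := by
      rw [div_le_iff₀' hε] at hN₁
      refine hN₁.trans ?_
      gcongr
      omega
    simp only [prU]
    rw [Fintype.card_prod, Fintype.card_fun, Fintype.card_fin, Fintype.card_fin, ← hK]
    rw [div_le_iff₀ (by exact_mod_cast Nat.mul_pos hK0 hJ0)]
    have hnR : (0 : ℝ) < ((n + N₀ : ℕ) : ℝ) := by exact_mod_cast hn0
    refine le_of_mul_le_mul_right ?_ hnR
    calc _ ≤ ((J * (c * (6 * K / (n + N₀))) : ℕ) : ℝ) * ((n + N₀ : ℕ) : ℝ) := by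
          gcongr
      _ = ((J * c * ((6 * K / (n + N₀)) * (n + N₀)) : ℕ) : ℝ) := by
          rw [← Nat.cast_mul]
          congr 1
          ring
      _ ≤ ((J * c * (6 * K) : ℕ) : ℝ) := by gcongr
      _ = (K * J : ℝ) * (6 * c : ℝ) := by
          push_cast
          ring
      _ ≤ (K * J : ℝ) * (ε * ((n + N₀ : ℕ) : ℝ)) := by gcongr
      _ = _ := by
          push_cast
          ring
  · intro n _ m5 m6 KB HB KE HE _ _ hKE α hα YE hYE
    have : Nonempty (Fin (Fintype.card (Matrix (Fin m2) (Fin ((n + N₀) ^ 2)) F))) :=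
      ⟨⟨0, Fintype.card_pos⟩⟩
    exact miU_attack_eq_zero (f n) (fun j => S n (e n j))
      (fun E hE => (hS n E hE).comp (e n).bijective) KE HE hKE α hα YE hYE
end

section
/- Let p be a prime, let M be uniformly distributed on F_p, let (Y1, Y2) be F_p-valued random variables produced from M and arbitrary scramble randomness, let A be a 2×2 matrix over F_p, set (Y3, Y4)ᵀ := A (Y1, Y2)ᵀ, and suppose there is a decoder ψ : F_p² → F_p with ψ(Y3, Y4) = M with probability 1. Then there exist i ∈ {1,2}, j ∈ {3,4}, and a function ψ̃ : F_p² → F_p with ψ̃(Y_i, Y_j) = M with probability 1. In other words, no linear code on the one hop relay network over F_p is imperfectly secure even against passive attacks. -/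
open scoped Classical in
/-- Probability of an event under a probability mass function `P` on a finite type. -/
noncomputable def prW {Ω : Type*} [Fintype Ω] (P : Ω → ℝ) (E : Ω → Prop) : ℝ :=
  ∑ ω : Ω, if E ω then P ω else 0

/-- no linear code on the one hop relay network over `F_p` (`p` prime) is
imperfectly secure, even against passive attacks: if a decoder recovers the uniform message
`M` from `(Y3, Y4) = A (Y1, Y2)ᵀ` with probability one, then Eve can recover `M` with
probability one from one of the pairs `(Y_i, Y_j)` with `i ∈ {1,2}`, `j ∈ {3,4}`. -/
theorem no_secure_linear_code_one_hop
    (p : ℕ) (hp : p.Prime) (Ω : Type) [Fintype Ω]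
    (P : Ω → ℝ) (hP0 : ∀ ω, 0 ≤ P ω) (hP1 : ∑ ω : Ω, P ω = 1)
    (M Y1 Y2 : Ω → ZMod p)
    (hMunif : ∀ m : ZMod p, prW P (fun ω => M ω = m) = 1 / p)
    (A : Matrix (Fin 2) (Fin 2) (ZMod p))
    (Y3 Y4 : Ω → ZMod p)
    (hY3 : ∀ ω, Y3 ω = A 0 0 * Y1 ω + A 0 1 * Y2 ω)
    (hY4 : ∀ ω, Y4 ω = A 1 0 * Y1 ω + A 1 1 * Y2 ω)
    (ψ : ZMod p × ZMod p → ZMod p)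
    (hdec : prW P (fun ω => ψ (Y3 ω, Y4 ω) = M ω) = 1) :
    ∃ (Yi Yj : Ω → ZMod p) (ψt : ZMod p × ZMod p → ZMod p),
      (Yi = Y1 ∨ Yi = Y2) ∧ (Yj = Y3 ∨ Yj = Y4) ∧
      prW P (fun ω => ψt (Yi ω, Yj ω) = M ω) = 1 := by
  have : Fact p.Prime := ⟨hp⟩
  have hY3' : Y3 = fun ω => A 0 0 * Y1 ω + A 0 1 * Y2 ω := funext hY3
  have hY4' : Y4 = fun ω => A 1 0 * Y1 ω + A 1 1 * Y2 ω := funext hY4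
  -- It suffices to recompute both `Y1` and `Y2` from the observed pair.
  have transfer : ∀ (Yi Yj : Ω → ZMod p) (f g : ZMod p × ZMod p → ZMod p),
      (Yi = Y1 ∨ Yi = Y2) → (Yj = Y3 ∨ Yj = Y4) →
      (∀ ω, f (Yi ω, Yj ω) = Y1 ω) → (∀ ω, g (Yi ω, Yj ω) = Y2 ω) →
      ∃ (Yi Yj : Ω → ZMod p) (ψt : ZMod p × ZMod p → ZMod p),
        (Yi = Y1 ∨ Yi = Y2) ∧ (Yj = Y3 ∨ Yj = Y4) ∧
        prW P (fun ω => ψt (Yi ω, Yj ω) = M ω) = 1 := by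
    intro Yi Yj f g hi hj hf hg
    refine ⟨Yi, Yj, fun y => ψ (A 0 0 * f y + A 0 1 * g y, A 1 0 * f y + A 1 1 * g y),
      hi, hj, ?_⟩
    simpa only [hf, hg, ← hY3, ← hY4] using hdec
  by_cases h00 : A 0 0 = 0
  · by_cases h01 : A 0 1 = 0
    · by_cases h10 : A 1 0 = 0
      · by_cases h11 : A 1 1 = 0
        · refine ⟨Y1, Y3, fun _ => ψ (0, 0), Or.inl rfl, Or.inl rfl, ?_⟩
          simpa [hY3', hY4', h00, h01, h10, h11] using hdec
        · exact transfer Y1 Y4 Prod.fst (fun y => (y.2 - A 1 0 * y.1) / A 1 1)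
            (Or.inl rfl) (Or.inr rfl) (fun _ => rfl)
            (fun ω => by simp only [hY4]; field_simp; ring)
      · exact transfer Y2 Y4 (fun y => (y.2 - A 1 1 * y.1) / A 1 0) Prod.fst
          (Or.inr rfl) (Or.inr rfl) (fun ω => by simp only [hY4]; field_simp; ring)
          (fun _ => rfl)
    · exact transfer Y1 Y3 Prod.fst (fun y => (y.2 - A 0 0 * y.1) / A 0 1)
        (Or.inl rfl) (Or.inl rfl) (fun _ => rfl)
        (fun ω => by simp only [hY3]; field_simp; ring)
  · exact transfer Y2 Y3 (fun y => (y.2 - A 0 1 * y.1) / A 0 0) Prod.fst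
      (Or.inr rfl) (Or.inl rfl) (fun ω => by simp only [hY3]; field_simp; ring)
      (fun _ => rfl)
end

section
/- Over F_2, let M and L be independent uniformly distributed bits and define Y1 := L, Y2 := M + L, Y3 := Y1·(Y2 + 1), Y4 := (Y1 + 1)·Y2. Then: (i) Y3 + Y4 = M always, so the decoder ψ(y3, y4) := y3 + y4 recovers M (recoverability); and (ii) for every i ∈ {1,2} and j ∈ {3,4}, no function ψ̃ : F_2² → F_2 satisfies ψ̃(Y_i, Y_j) = M with probability 1. Hence this nonlinear code on the one hop relay network with d = 2 is imperfectly secure against passive attacks. -/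
/-- An event of probability one under the uniform distribution holds everywhere. -/
theorem forall_of_prU_eq_one {Ω : Type*} [Fintype Ω] {E : Ω → Prop} (h : prU E = 1) (ω : Ω) :
    E ω := by
  classical
  have hΩ : (Fintype.card Ω : ℝ) ≠ 0 := by
    exact_mod_cast (Fintype.card_pos_iff.mpr ⟨ω⟩).ne'
  rw [prU, div_eq_one_iff_eq hΩ, Nat.card_eq_fintype_card, Nat.cast_inj] at h
  by_contra hω
  exact (Fintype.card_subtype_lt hω).ne h

/-- If an observation `Y` takes the same value at two outcomes where `X` differs, then no function
of `Y` equals `X` with probability one. -/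
theorem prU_comp_eq_ne_one {Ω α β : Type*} [Fintype Ω] {Y : Ω → α} {X : Ω → β} {ω ω' : Ω}
    (hY : Y ω = Y ω') (hX : X ω ≠ X ω') (ψ : α → β) : prU (fun ω => ψ (Y ω) = X ω) ≠ 1 := fun h =>
  hX <| by rw [← forall_of_prU_eq_one h ω, hY, forall_of_prU_eq_one h ω']

/-- for the nonlinear code over `F_2` given by `Y1 = L`, `Y2 = M + L`,
`Y3 = Y1 (Y2 + 1)`, `Y4 = (Y1 + 1) Y2` (with `M, L` independent uniform bits, modelled by
the uniform distribution on pairs `ω = (M, L)`): (i) `Y3 + Y4 = M` always (recoverability);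
(ii) no function of `(Y_i, Y_j)` (`i ∈ {1,2}`, `j ∈ {3,4}`) equals `M` with probability 1
(imperfect security against passive attacks). -/
theorem nonlinear_code_d2_passively_secure :
    (∀ m l : ZMod 2, l * ((m + l) + 1) + (l + 1) * (m + l) = m) ∧
    (∀ Yi Yj : ZMod 2 → ZMod 2 → ZMod 2,
      (Yi = (fun _ l => l) ∨ Yi = (fun m l => m + l)) →
      (Yj = (fun m l => l * ((m + l) + 1)) ∨ Yj = (fun m l => (l + 1) * (m + l))) →
      ∀ ψt : ZMod 2 × ZMod 2 → ZMod 2,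
        ¬ prU (fun ω : ZMod 2 × ZMod 2 => ψt (Yi ω.1 ω.2, Yj ω.1 ω.2) = ω.1) = 1) := by
  refine ⟨by decide, ?_⟩
  rintro _ _ (rfl | rfl) (rfl | rfl) ψt
  · exact prU_comp_eq_ne_one (ω := (0, 0)) (ω' := (1, 0)) (by decide) (by decide) ψt
  · exact prU_comp_eq_ne_one (ω := (0, 1)) (ω' := (1, 1)) (by decide) (by decide) ψt
  · exact prU_comp_eq_ne_one (ω := (0, 1)) (ω' := (1, 0)) (by decide) (by decide) ψt
  · exact prU_comp_eq_ne_one (ω := (0, 0)) (ω' := (1, 1)) (by decide) (by decide) ψt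
end

section
/- Over F_2, let M and L be independent uniformly distributed bits and define Y1 := L, Y2 := M + L, Y3 := Y1·(Y2 + 1), Y4 := (Y1 + 1)·Y2. Then the mutual informations (with natural logarithm) satisfy I(M; (Y1, Y3)) = I(M; (Y1, Y4)) = I(M; (Y2, Y3)) = I(M; (Y2, Y4)) = (1/2)·log 2, i.e., exactly half a bit is leaked to Eve for each allowed pair of eavesdropped edges. -/
theorem prU_eq_card_filter {Ω : Type*} [Fintype Ω] (E : Ω → Prop) [DecidablePred E] :
    prU E = ((Finset.univ.filter E).card : ℝ) / (Fintype.card Ω : ℝ) := by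
  rw [prU, Nat.card_eq_fintype_card, Fintype.card_subtype]

/-- Entropy as an average over the sample space of the log-sizes of the fibres. -/
theorem entU_eq_log_card_sub {Ω A : Type*} [Fintype Ω] [Nonempty Ω] [Fintype A] [DecidableEq A]
    (X : Ω → A) :
    entU X = Real.log (Fintype.card Ω) - (∑ ω : Ω,
      Real.log ((Finset.univ.filter fun ω' => X ω' = X ω).card : ℝ)) / Fintype.card Ω := by
  have hN : (Fintype.card Ω : ℝ) ≠ 0 := by simp
  have key : ∑ ω : Ω, Real.log (prU fun ω' => X ω' = X ω) =
      ∑ a : A, ((Finset.univ.filter fun ω => X ω = a).card : ℝ) *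
        Real.log (prU fun ω => X ω = a) := by
    rw [← Finset.sum_fiberwise Finset.univ X]
    refine Finset.sum_congr rfl fun a _ => ?_
    rw [← nsmul_eq_mul]
    refine Finset.sum_eq_card_nsmul fun ω hω => ?_
    rw [(Finset.mem_filter.mp hω).2]
  have hent : entU X = -((∑ ω : Ω, Real.log (prU fun ω' => X ω' = X ω)) / Fintype.card Ω) := by
    rw [key, entU, Finset.sum_div]
    congr 1
    refine Finset.sum_congr rfl fun a _ => ?_
    rw [mul_div_right_comm, ← prU_eq_card_filter]
  have hlog (ω : Ω) : Real.log (prU fun ω' => X ω' = X ω) =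
      Real.log ((Finset.univ.filter fun ω' => X ω' = X ω).card : ℝ) -
        Real.log (Fintype.card Ω) := by
    rw [prU_eq_card_filter, Real.log_div _ hN]
    exact Nat.cast_ne_zero.mpr (Finset.card_ne_zero_of_mem (a := ω) (by simp))
  rw [hent]
  simp only [hlog, Finset.sum_sub_distrib, Finset.sum_const, Finset.card_univ, nsmul_eq_mul]
  field_simp
  ring

/-- If `X` is a uniform bit on a four-point space, `Y` has two singleton fibres and one fibre
of size two, and `(X, Y)` is injective, then `Y` leaks half a bit about `X`. -/
theorem miU_eq_half_log_two {Ω A B : Type*} [Fintype Ω] [Fintype A] [Fintype B]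
    [DecidableEq Ω] [DecidableEq A] [DecidableEq B] (X : Ω → A) (Y : Ω → B)
    (hΩ : Fintype.card Ω = 4)
    (hX : ∀ ω, (Finset.univ.filter fun ω' => X ω' = X ω).card = 2)
    (hXY : ∀ ω, (Finset.univ.filter fun ω' => (X ω', Y ω') = (X ω, Y ω)).card = 1)
    (s : Finset Ω) (hs : s.card = 2)
    (hY : ∀ ω, (Finset.univ.filter fun ω' => Y ω' = Y ω).card = if ω ∈ s then 2 else 1) :
    miU X Y = (1 / 2) * Real.log 2 := by
  have : Nonempty Ω := Fintype.card_pos_iff.mp (by omega)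
  have hsum : ∑ ω : Ω, Real.log ((if ω ∈ s then 2 else 1 : ℕ) : ℝ) = 2 * Real.log 2 := by
    have h (ω : Ω) : Real.log ((if ω ∈ s then 2 else 1 : ℕ) : ℝ) =
        if ω ∈ s then Real.log 2 else 0 := by
      split_ifs <;> simp
    simp only [h, Finset.sum_ite_mem, Finset.univ_inter, Finset.sum_const, hs, nsmul_eq_mul,
      Nat.cast_ofNat]
  have h4 : Real.log 4 = 2 * Real.log 2 := by
    rw [show (4 : ℝ) = 2 ^ 2 by norm_num, Real.log_pow, Nat.cast_ofNat]
  rw [miU, entU_eq_log_card_sub X, entU_eq_log_card_sub Y, entU_eq_log_card_sub fun ω => (X ω, Y ω)]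
  simp only [hX, hXY, hY, hsum, hΩ, Finset.sum_const, Finset.card_univ, nsmul_eq_mul,
    Nat.cast_ofNat, Nat.cast_one, Real.log_one, h4]
  ring

/-- for the nonlinear code over `F_2` with `M, L` independent uniform bits
(modelled by the uniform distribution on pairs `ω = (M, L)`), `Y1 = L`, `Y2 = M + L`,
`Y3 = Y1 (Y2 + 1)`, `Y4 = (Y1 + 1) Y2`, each of the four allowed eavesdropped pairs leaks
exactly half a bit: `I(M; (Y_i, Y_j)) = (1/2) log 2`. -/
theorem nonlinear_code_d2_leaks_half_a_bit :
    miU (fun ω : ZMod 2 × ZMod 2 => ω.1)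
        (fun ω : ZMod 2 × ZMod 2 => (ω.2, ω.2 * ((ω.1 + ω.2) + 1)))
      = (1 / 2) * Real.log 2 ∧
    miU (fun ω : ZMod 2 × ZMod 2 => ω.1)
        (fun ω : ZMod 2 × ZMod 2 => (ω.2, (ω.2 + 1) * (ω.1 + ω.2)))
      = (1 / 2) * Real.log 2 ∧
    miU (fun ω : ZMod 2 × ZMod 2 => ω.1)
        (fun ω : ZMod 2 × ZMod 2 => (ω.1 + ω.2, ω.2 * ((ω.1 + ω.2) + 1)))
      = (1 / 2) * Real.log 2 ∧
    miU (fun ω : ZMod 2 × ZMod 2 => ω.1)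
        (fun ω : ZMod 2 × ZMod 2 => (ω.1 + ω.2, (ω.2 + 1) * (ω.1 + ω.2)))
      = (1 / 2) * Real.log 2 := by
  refine ⟨?_, ?_, ?_, ?_⟩
  · exact miU_eq_half_log_two _ _ (by decide) (by decide) (by decide)
      {(0, 0), (1, 0)} (by decide) (by decide)
  · exact miU_eq_half_log_two _ _ (by decide) (by decide) (by decide)
      {(0, 1), (1, 1)} (by decide) (by decide)
  · exact miU_eq_half_log_two _ _ (by decide) (by decide) (by decide)
      {(0, 1), (1, 0)} (by decide) (by decide)
  · exact miU_eq_half_log_two _ _ (by decide) (by decide) (by decide)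
      {(0, 0), (1, 1)} (by decide) (by decide)
end

section
/- Let d = 2. For every code on the one hop relay network over F_2 — i.e., every encoder producing (Y1, Y2) ∈ F_2² from the uniform message M ∈ F_2 and arbitrary scramble randomness, every deterministic intermediate map φ : F_2² → F_2², and every decoder ψ with ψ(φ(Y1, Y2)) = M with probability 1 — the code is not imperfectly secure against active attacks: there exist i ∈ {1,2}, j ∈ {3,4}, a replacement function Y_i ↦ Y_i', and a function ψ̃ : F_2³ → F_2 such that ψ̃(Y_i, Y_i', Y_j') = M with probability 1, where (Y3', Y4') is computed by φ from the pair with Y_i replaced by Y_i'. -/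
theorem prW_eq_one_of_imp {Ω : Type*} [Fintype Ω] {P : Ω → ℝ} (hP0 : ∀ ω, 0 ≤ P ω)
    (hP1 : ∑ ω : Ω, P ω = 1) {E F : Ω → Prop} (hEF : ∀ ω, E ω → F ω) (hE : prW P E = 1) :
    prW P F = 1 := by
  classical
  apply le_antisymm
  · rw [← hP1]
    unfold prW
    refine Finset.sum_le_sum fun ω _ => ?_
    split_ifs
    exacts [le_rfl, hP0 ω]
  · rw [← hE]
    unfold prW
    refine Finset.sum_le_sum fun ω _ => ?_
    by_cases h : E ω
    · simp [h, hEF ω h]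
    · simp only [h, if_false]
      split_ifs
      exacts [hP0 ω, le_rfl]

/-- A function on `ZMod 2` that is not constant is injective. -/
theorem ZMod.injective_of_apply_ne {α : Type*} {g : ZMod 2 → α} {b c : ZMod 2}
    (h : g b ≠ g c) : Function.Injective g := by
  have pairs : ∀ b c x y : ZMod 2, b ≠ c → x ≠ y → x = b ∧ y = c ∨ x = c ∧ y = b := by decide
  intro x y hxy
  by_contra hne
  obtain ⟨rfl, rfl⟩ | ⟨rfl, rfl⟩ := pairs b c x y (fun e => h (congrArg g e)) hne
  exacts [h hxy, h hxy.symm]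

/-- If the decoded message is sensitive to the second input when the first one equals `a`, then
replacing the first input by `a` reveals the second one; otherwise the first input suffices. -/
theorem exists_attack_on_first_edge (φ : ZMod 2 × ZMod 2 → ZMod 2 × ZMod 2)
    (ψ : ZMod 2 × ZMod 2 → ZMod 2) :
    ∃ (j : Fin 2) (r : ZMod 2 → ZMod 2) (ψt : ZMod 2 → ZMod 2 → ZMod 2 → ZMod 2),
      ∀ x y, ψt x (r x) (if j = 0 then (φ (r x, y)).1 else (φ (r x, y)).2) = ψ (φ (x, y)) := by
  by_cases h : ∀ a b c, ψ (φ (a, b)) = ψ (φ (a, c))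
  · exact ⟨0, id, fun x _ _ => ψ (φ (x, 0)), fun x y => h x 0 y⟩
  · push Not at h
    obtain ⟨a, b, c, hne⟩ := h
    have hφ : φ (a, b) ≠ φ (a, c) := fun e => hne (congrArg ψ e)
    have key : ∃ j : Fin 2, Function.Injective
        fun y => if j = 0 then (φ (a, y)).1 else (φ (a, y)).2 := by
      by_cases h1 : (φ (a, b)).1 = (φ (a, c)).1
      · exact ⟨1, ZMod.injective_of_apply_ne (b := b) (c := c)
          fun h2 => hφ (Prod.ext h1 (by simpa using h2))⟩
      · exact ⟨0, ZMod.injective_of_apply_ne (b := b) (c := c) (by simpa using h1)⟩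
    obtain ⟨j, hj⟩ := key
    exact ⟨j, fun _ => a, fun x _ z => ψ (φ (x, Function.invFun _ z)),
      fun x y => congrArg (fun t => ψ (φ (x, t))) (Function.leftInverse_invFun hj y)⟩

/-- for `d = 2`, no code on the one hop relay network over `F_2` is
imperfectly secure against active attacks: for every encoder producing `(Y1, Y2)` from
the uniform message `M` and arbitrary scramble randomness, every deterministic intermediate
map `φ` and every decoder recovering `M` with probability one, there are an attacked edge
`i ∈ {1,2}`, an observed edge `j ∈ {3,4}`, a replacement function `r` and a function `ψt`
recovering `M` with probability one from `(Y_i, Y_i', Y_j')`. -/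
theorem no_actively_secure_code_d2
    (Ω : Type) [Fintype Ω]
    (P : Ω → ℝ) (hP0 : ∀ ω, 0 ≤ P ω) (hP1 : ∑ ω : Ω, P ω = 1)
    (M Y1 Y2 : Ω → ZMod 2)
    (hMunif : ∀ m : ZMod 2, prW P (fun ω => M ω = m) = 1 / 2)
    (φ : ZMod 2 × ZMod 2 → ZMod 2 × ZMod 2)
    (ψ : ZMod 2 × ZMod 2 → ZMod 2)
    (hdec : prW P (fun ω => ψ (φ (Y1 ω, Y2 ω)) = M ω) = 1) :
    ∃ (i j : Fin 2) (r : ZMod 2 → ZMod 2) (ψt : ZMod 2 → ZMod 2 → ZMod 2 → ZMod 2),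
      prW P (fun ω =>
        ψt (if i = 0 then Y1 ω else Y2 ω)
           (r (if i = 0 then Y1 ω else Y2 ω))
           (if j = 0
              then (if i = 0 then φ (r (Y1 ω), Y2 ω) else φ (Y1 ω, r (Y2 ω))).1
              else (if i = 0 then φ (r (Y1 ω), Y2 ω) else φ (Y1 ω, r (Y2 ω))).2)
          = M ω) = 1 := by
  obtain ⟨j, r, ψt, h⟩ := exists_attack_on_first_edge φ ψ
  refine ⟨0, j, r, ψt, prW_eq_one_of_imp hP0 hP1 (fun ω hω => ?_) hdec⟩
  simpa only [if_true] using (h (Y1 ω) (Y2 ω)).trans hω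
end

section
/- Let d ≥ 2, let M and L be independent uniform random variables on Z_d, and use the encoder Y1 := M + L, Y2 := L with intermediate map (Y3, Y4) := (φ3(Y1, Y2), φ4(Y1, Y2)) for functions φ3, φ4 : Z_d × Z_d → Z_d. Then: recoverability (B1) holds if and only if condition (B1') holds (for each a ∈ Z_d and m ≠ m' in Z_d, Ξ_{a,m} ∩ Ξ_{a,m'} = ∅); and imperfect security against active attacks (B2) holds if and only if condition (B2') holds (both φ3 and φ4, regarded as d×d matrices, are anti-Latin squares). -/
/-- The set `Ξ_{a,m} = { φ4(i, i+m) : i ∈ Z_d, φ3(i, i+m) = a }`. -/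
def XiSet (d : ℕ) (φ3 φ4 : ZMod d → ZMod d → ZMod d) (a m : ZMod d) : Set (ZMod d) :=
  {c | ∃ i : ZMod d, φ3 i (i + m) = a ∧ φ4 i (i + m) = c}

/-- A `d × d` matrix over `Z_d` (given as a function) is an anti-Latin square if every row
and every column contains two equal entries. -/
def IsAntiLatin (d : ℕ) (f : ZMod d → ZMod d → ZMod d) : Prop :=
  (∀ i : ZMod d, ∃ j j' : ZMod d, j ≠ j' ∧ f i j = f i j') ∧
  (∀ j : ZMod d, ∃ i i' : ZMod d, i ≠ i' ∧ f i j = f i' j)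

/-- Recoverability (B1) for the one hop relay network with encoder `Y1 = M + L`, `Y2 = L`
(`M, L` independent uniform on `Z_d`, so "with probability 1" means "for all `(m, l)`"):
some decoder recovers `M` from `(Y3, Y4)`. -/
def CondB1 (d : ℕ) (φ3 φ4 : ZMod d → ZMod d → ZMod d) : Prop :=
  ∃ ψ : ZMod d × ZMod d → ZMod d, ∀ m l : ZMod d, ψ (φ3 (m + l) l, φ4 (m + l) l) = m

/-- Condition (B1'): for every `a` and `m ≠ m'`, `Ξ_{a,m} ∩ Ξ_{a,m'} = ∅`. -/
def CondB1' (d : ℕ) (φ3 φ4 : ZMod d → ZMod d → ZMod d) : Prop :=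
  ∀ a m m' : ZMod d, m ≠ m' → XiSet d φ3 φ4 a m ∩ XiSet d φ3 φ4 a m' = ∅

/-- Imperfect security against active attacks (B2): no attack in which Eve observes
`Y_i` (`i ∈ {1,2}`), replaces it by `r(Y_i)`, and then observes `Y_j'` (`j ∈ {3,4}`)
computed from the modified pair recovers `M` with probability 1 (i.e. for all `(m, l)`). -/
def CondB2 (d : ℕ) (φ3 φ4 : ZMod d → ZMod d → ZMod d) : Prop :=
  ¬ ∃ (i j : Fin 2) (r : ZMod d → ZMod d) (ψt : ZMod d → ZMod d → ZMod d → ZMod d),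
      ∀ m l : ZMod d,
        ψt (if i = 0 then m + l else l)
           (r (if i = 0 then m + l else l))
           (if j = 0
              then (if i = 0 then φ3 (r (m + l)) l else φ3 (m + l) (r l))
              else (if i = 0 then φ4 (r (m + l)) l else φ4 (m + l) (r l)))
          = m

/-- Condition (B2'): both `φ3` and `φ4` are anti-Latin squares. -/
def CondB2' (d : ℕ) (φ3 φ4 : ZMod d → ZMod d → ZMod d) : Prop :=
  IsAntiLatin d φ3 ∧ IsAntiLatin d φ4

theorem condB1_iff_condB1' (d : ℕ) (φ3 φ4 : ZMod d → ZMod d → ZMod d) :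
    CondB1 d φ3 φ4 ↔ CondB1' d φ3 φ4 := by
  constructor
  · rintro ⟨ψ, hψ⟩ a m m' hne
    refine Set.eq_empty_iff_forall_notMem.2 ?_
    rintro c ⟨⟨i, hi, hi'⟩, ⟨k, hk, hk'⟩⟩
    have h₁ := hψ (-m) (i + m)
    have h₂ := hψ (-m') (k + m')
    rw [show -m + (i + m) = i by ring, hi, hi'] at h₁
    rw [show -m' + (k + m') = k by ring, hk, hk', h₁] at h₂
    exact hne (neg_injective h₂)
  · intro h
    have hfac : Function.FactorsThrough (Prod.fst : ZMod d × ZMod d → ZMod d)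
        (fun p : ZMod d × ZMod d => (φ3 (p.1 + p.2) p.2, φ4 (p.1 + p.2) p.2)) := by
      rintro ⟨m, l⟩ ⟨m', l'⟩ hEq
      simp only [Prod.mk.injEq] at hEq
      by_contra hne
      have hmem : φ4 (m + l) l ∈ XiSet d φ3 φ4 (φ3 (m + l) l) (-m) ∩
          XiSet d φ3 φ4 (φ3 (m + l) l) (-m') := by
        refine ⟨⟨m + l, ?_⟩, ⟨m' + l', ?_⟩⟩
        · simp
        · simp [hEq]
      rw [h _ _ _ fun h' => hne (neg_injective h')] at hmem
      exact hmem
    exact ⟨Function.extend _ Prod.fst 0, fun m l => hfac.extend_apply 0 (m, l)⟩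

/-- Intercepting `Y1` reveals the message through `f` exactly when some row of `f` has
distinct entries. -/
theorem exists_row_attack_iff (d : ℕ) (f : ZMod d → ZMod d → ZMod d) :
    (∃ (r : ZMod d → ZMod d) (ψ : ZMod d → ZMod d → ZMod d → ZMod d),
      ∀ m l : ZMod d, ψ (m + l) (r (m + l)) (f (r (m + l)) l) = m) ↔
    ∃ i, Function.Injective (f i) := by
  constructor
  · rintro ⟨r, ψ, h⟩
    refine ⟨r 0, fun l l' hl => ?_⟩
    have h₁ := h (-l) l
    have h₂ := h (-l') l'
    rw [neg_add_cancel] at h₁ h₂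
    rw [hl, h₂] at h₁
    exact (neg_injective h₁).symm
  · rintro ⟨i, hi⟩
    refine ⟨fun _ => i, fun y _ z => y - Function.invFun (f i) z, fun m l => ?_⟩
    simp only [Function.leftInverse_invFun hi l, add_sub_cancel_right]

/-- Intercepting `Y2` reveals the message through `f` exactly when some column of `f` has
distinct entries. -/
theorem exists_column_attack_iff (d : ℕ) (f : ZMod d → ZMod d → ZMod d) :
    (∃ (r : ZMod d → ZMod d) (ψ : ZMod d → ZMod d → ZMod d → ZMod d),
      ∀ m l : ZMod d, ψ l (r l) (f (m + l) (r l)) = m) ↔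
    ∃ j, Function.Injective fun i => f i j := by
  constructor
  · rintro ⟨r, ψ, h⟩
    refine ⟨r 0, fun m m' (hm : f m (r 0) = f m' (r 0)) => ?_⟩
    have h₁ := h m 0
    have h₂ := h m' 0
    rw [add_zero] at h₁ h₂
    rw [← h₁, hm, h₂]
  · rintro ⟨j, hj⟩
    refine ⟨fun _ => j, fun y _ z => Function.invFun (fun i => f i j) z - y, fun m l => ?_⟩
    have h : Function.invFun (fun i => f i j) (f (m + l) j) = m + l :=
      Function.leftInverse_invFun hj (m + l)
    simp only [h, add_sub_cancel_right]

theorem isAntiLatin_iff (d : ℕ) (f : ZMod d → ZMod d → ZMod d) :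
    IsAntiLatin d f ↔
      (¬ ∃ i, Function.Injective (f i)) ∧ ¬ ∃ j, Function.Injective fun i => f i j := by
  simp only [IsAntiLatin, not_exists, Function.not_injective_iff, and_comm]

/-- for the one hop relay network over `Z_d` (`d ≥ 2`) with encoder
`Y1 = M + L`, `Y2 = L` and intermediate map `(φ3, φ4)`, recoverability (B1) holds iff
(B1') holds, and imperfect security against active attacks (B2) holds iff (B2') holds. -/
theorem B1_iff_B1'_and_B2_iff_B2'
    (d : ℕ) (hd : 2 ≤ d) (φ3 φ4 : ZMod d → ZMod d → ZMod d) :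
    (CondB1 d φ3 φ4 ↔ CondB1' d φ3 φ4) ∧ (CondB2 d φ3 φ4 ↔ CondB2' d φ3 φ4) := by
  refine ⟨condB1_iff_condB1' d φ3 φ4, ?_⟩
  simp only [CondB2, CondB2', Fin.exists_fin_two, if_true, one_ne_zero, if_false,
    exists_row_attack_iff, exists_column_attack_iff, isAntiLatin_iff]
  tauto
end

section
/- For every integer d ≥ 3 there exist functions φ3, φ4 : Z_d × Z_d → Z_d satisfying both (B1') and (B2'); that is, there exists a decodable pair of d×d anti-Latin squares. Consequently, for every d ≥ 3, the one hop relay network code with encoder Y1 := M + L, Y2 := L (M, L independent uniform on Z_d) and intermediate map (φ3, φ4) satisfies recoverability (B1) and is imperfectly secure against active attacks (B2). -/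
/-- Decodability (B1') implies recoverability (B1). -/
theorem CondB1'.condB1 {d : ℕ} {φ3 φ4 : ZMod d → ZMod d → ZMod d} (h : CondB1' d φ3 φ4) :
    CondB1 d φ3 φ4 := by
  classical
  refine ⟨fun y => if hy : ∃ m l : ZMod d, (φ3 (m + l) l, φ4 (m + l) l) = y
    then hy.choose else 0, fun m l => ?_⟩
  have hy : ∃ m' l' : ZMod d,
      (φ3 (m' + l') l', φ4 (m' + l') l') = (φ3 (m + l) l, φ4 (m + l) l) := ⟨m, l, rfl⟩
  beta_reduce
  rw [dif_pos hy]
  obtain ⟨l', hl'⟩ := hy.choose_spec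
  generalize hy.choose = m' at hl'
  obtain ⟨h3, h4⟩ := Prod.mk.inj hl'
  by_contra hne
  have hmem : φ4 (m + l) l ∈ XiSet d φ3 φ4 (φ3 (m + l) l) (-m') ∩
      XiSet d φ3 φ4 (φ3 (m + l) l) (-m) := by
    refine ⟨⟨m' + l', ?_, ?_⟩, ⟨m + l, ?_, ?_⟩⟩ <;> simp [h3, h4]
  rw [h _ _ _ (neg_injective.ne hne)] at hmem
  exact hmem

/-- If both coordinates are anti-Latin squares (B2'), then no active attack succeeds (B2). -/
theorem CondB2'.condB2 {d : ℕ} {φ3 φ4 : ZMod d → ZMod d → ZMod d} (h : CondB2' d φ3 φ4) :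
    CondB2 d φ3 φ4 := by
  rintro ⟨i, j, r, ψt, hψ⟩
  obtain ⟨⟨hrow3, hcol3⟩, ⟨hrow4, hcol4⟩⟩ := h
  have hrow (f : ZMod d → ZMod d → ZMod d)
      (hf : ∀ i : ZMod d, ∃ j j' : ZMod d, j ≠ j' ∧ f i j = f i j')
      (H : ∀ m l, ψt (m + l) (r (m + l)) (f (r (m + l)) l) = m) : False := by
    obtain ⟨l, l', hne, heq⟩ := hf (r 0)
    have h1 := H (-l) l
    have h2 := H (-l') l'
    rw [neg_add_cancel] at h1 h2
    exact hne (neg_injective (h1.symm.trans ((congrArg _ heq).trans h2)))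
  have hcol (f : ZMod d → ZMod d → ZMod d)
      (hf : ∀ j : ZMod d, ∃ i i' : ZMod d, i ≠ i' ∧ f i j = f i' j)
      (H : ∀ m l, ψt l (r l) (f (m + l) (r l)) = m) : False := by
    obtain ⟨m, m', hne, heq⟩ := hf (r 0)
    have h1 := H m 0
    have h2 := H m' 0
    rw [add_zero] at h1 h2
    exact hne (h1.symm.trans ((congrArg _ heq).trans h2))
  fin_cases i <;> fin_cases j
  · exact hrow φ3 hrow3 (by simpa using hψ)
  · exact hrow φ4 hrow4 (by simpa using hψ)
  · exact hcol φ3 hcol3 (by simpa using hψ)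
  · exact hcol φ4 hcol4 (by simpa using hψ)

/-- The row index, shifted by one on the diagonal. -/
def diagShift (d : ℕ) (i j : ZMod d) : ZMod d := if i = j then i + 1 else i

theorem IsAntiLatin.swap {d : ℕ} {f : ZMod d → ZMod d → ZMod d} (h : IsAntiLatin d f) :
    IsAntiLatin d (fun i j => f j i) := ⟨h.2, h.1⟩

theorem isAntiLatin_diagShift {d : ℕ} (hd : 3 ≤ d) : IsAntiLatin d (diagShift d) := by
  have : Fact (1 < d) := ⟨by omega⟩
  have h2 : (2 : ZMod d) ≠ 0 := by
    intro h
    have := Nat.le_of_dvd two_pos ((ZMod.natCast_eq_zero_iff 2 d).1 (mod_cast h))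
    omega
  refine ⟨fun i => ⟨i + 1, i + 2, ?_, ?_⟩, fun j => ⟨j, j + 1, ?_, ?_⟩⟩
  · rw [← one_add_one_eq_two, ← add_assoc]
    simp
  · simp [diagShift, h2]
  · simp
  · simp [diagShift]

/-- The pair `(diagShift d i j, diagShift d j i)` has the same difference as `(i, j)`. -/
theorem diagShift_sub_diagShift (d : ℕ) (i j : ZMod d) :
    diagShift d j i - diagShift d i j = j - i := by
  by_cases h : i = j
  · simp [h]
  · simp [diagShift, h, Ne.symm h]

theorem condB1'_diagShift (d : ℕ) :
    CondB1' d (diagShift d) (fun i j => diagShift d j i) := by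
  intro a m m' hne
  refine Set.eq_empty_of_forall_notMem ?_
  rintro c ⟨⟨i, hi3, hi4⟩, ⟨k, hk3, hk4⟩⟩
  beta_reduce at hi4 hk4
  have h := diagShift_sub_diagShift d i (i + m)
  have h' := diagShift_sub_diagShift d k (k + m')
  rw [hi3, hi4, add_sub_cancel_left] at h
  rw [hk3, hk4, add_sub_cancel_left] at h'
  exact hne (h.symm.trans h')

/-- for every `d ≥ 3` there is a decodable pair of `d × d` anti-Latin squares,
i.e. functions `φ3, φ4` satisfying both (B1') and (B2'); consequently the corresponding one
hop relay network code satisfies recoverability (B1) and active imperfect security (B2). -/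
theorem exists_decodable_antiLatin_pair (d : ℕ) (hd : 3 ≤ d) :
    ∃ φ3 φ4 : ZMod d → ZMod d → ZMod d,
      CondB1' d φ3 φ4 ∧ CondB2' d φ3 φ4 ∧ CondB1 d φ3 φ4 ∧ CondB2 d φ3 φ4 := by
  have h1 := condB1'_diagShift d
  have h2 : CondB2' d (diagShift d) (fun i j => diagShift d j i) :=
    ⟨isAntiLatin_diagShift hd, (isAntiLatin_diagShift hd).swap⟩
  exact ⟨_, _, h1, h2, h1.condB1, h2.condB2⟩
end

section
/- Let d = 2ℓ + 1 with ℓ ≥ 1. Define φ3, φ4 : Z_d × Z_d → Z_d by: φ3(i, j) := i if i − j ∈ {0, 1, …, ℓ} (mod d) and φ3(i, j) := j otherwise; φ4(i, j) := i − ℓ if i − j ∈ {ℓ, ℓ+1, …, 2ℓ} (mod d) and φ4(i, j) := j otherwise. Then (φ3, φ4) satisfies condition (B1') and both φ3 and φ4 are anti-Latin squares (condition (B2')); in fact Ξ_{a,m} is the singleton {a + m} when −m ∈ {0,…,ℓ−1} or −m = ℓ, and {a − m − ℓ} when −m ∈ {ℓ+1,…,2ℓ}, and these singletons are pairwise distinct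 as m varies. -/
/-- For `d = 2ℓ + 1`, elements `x, y` of `Z_d` with residues in `{0, …, ℓ}` and
`{ℓ+1, …, 2ℓ}` respectively never satisfy `x + y = ℓ`. -/
theorem ZMod.add_ne_natCast_of_val_le_of_lt_val {ℓ d : ℕ} (hd : d = 2 * ℓ + 1) {x y : ZMod d}
    (hx : x.val ≤ ℓ) (hy : ℓ < y.val) : x + y ≠ (ℓ : ZMod d) := by
  have : NeZero d := ⟨by omega⟩
  intro h
  have hy' := y.val_lt
  have h0 : ((x.val + y.val - ℓ : ℕ) : ZMod d) = 0 := by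
    rw [Nat.cast_sub (by omega), Nat.cast_add, ZMod.natCast_zmod_val, ZMod.natCast_zmod_val, h,
      sub_self]
  have := Nat.le_of_dvd (by omega) ((ZMod.natCast_eq_zero_iff _ _).1 h0)
  omega

/-- for odd `d = 2ℓ + 1` (`ℓ ≥ 1`), the explicit pair
`φ3(i,j) = i` if `i - j ∈ {0, …, ℓ}` else `j`, and
`φ4(i,j) = i - ℓ` if `i - j ∈ {ℓ, …, 2ℓ}` else `j`,
satisfies (B1') and both `φ3` and `φ4` are anti-Latin squares; in fact `Ξ_{a,m}` is the
singleton `{a + m}` when `(-m) ∈ {0, …, ℓ}` and `{a - m - ℓ}` when `(-m) ∈ {ℓ+1, …, 2ℓ}`,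
and these singletons are pairwise distinct as `m` varies. -/
theorem odd_d_explicit_antiLatin_pair
    (ℓ d : ℕ) (hℓ : 1 ≤ ℓ) (hd : d = 2 * ℓ + 1)
    (φ3 φ4 : ZMod d → ZMod d → ZMod d)
    (hφ3 : ∀ i j : ZMod d, φ3 i j = if (i - j).val ≤ ℓ then i else j)
    (hφ4 : ∀ i j : ZMod d,
      φ4 i j = if ℓ ≤ (i - j).val ∧ (i - j).val ≤ 2 * ℓ then i - (ℓ : ZMod d) else j) :
    CondB1' d φ3 φ4 ∧ IsAntiLatin d φ3 ∧ IsAntiLatin d φ4 ∧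
    (∀ a m : ZMod d,
      ((-m).val ≤ ℓ → XiSet d φ3 φ4 a m = {a + m}) ∧
      (ℓ < (-m).val → XiSet d φ3 φ4 a m = {a - m - (ℓ : ZMod d)})) ∧
    (∀ a m m' : ZMod d, m ≠ m' → XiSet d φ3 φ4 a m ≠ XiSet d φ3 φ4 a m') := by
  have : NeZero d := ⟨by omega⟩
  have : Fact (1 < d) := ⟨by omega⟩
  have hval_one : (1 : ZMod d).val = 1 := ZMod.val_one d
  have hval_neg_one : (-1 : ZMod d).val = 2 * ℓ := by
    subst hd
    exact ZMod.val_neg_one (2 * ℓ)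
  have hval_ℓ : (ℓ : ZMod d).val = ℓ := ZMod.val_cast_of_lt (by omega)
  have hℓ0 : (ℓ : ZMod d) ≠ 0 := fun h => by
    rw [h, ZMod.val_zero] at hval_ℓ
    omega
  have hdiff : ∀ i m : ZMod d, i - (i + m) = -m := fun i m => by ring
  have hsmall : ∀ a m : ZMod d, (-m).val ≤ ℓ → XiSet d φ3 φ4 a m = {a + m} := by
    intro a m hm
    have h4 : φ4 a (a + m) = a + m := by
      rw [hφ4, hdiff]
      split_ifs with h
      · have : -m = (ℓ : ZMod d) := by
          rw [← ZMod.natCast_zmod_val (-m), le_antisymm hm h.1]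
        rw [← this]
        ring
      · rfl
    ext c
    simp only [XiSet, hφ3, hdiff, if_pos hm, Set.mem_ofPred_eq, Set.mem_singleton_iff,
      exists_eq_left, h4]
    exact eq_comm
  have hlarge : ∀ a m : ZMod d, ℓ < (-m).val →
      XiSet d φ3 φ4 a m = {a - m - (ℓ : ZMod d)} := by
    intro a m hm
    have hlt := (-m).val_lt
    ext c
    simp only [XiSet, hφ3, hφ4, hdiff, if_neg hm.not_ge,
      if_pos (show ℓ ≤ (-m).val ∧ (-m).val ≤ 2 * ℓ by omega), Set.mem_ofPred_eq,
      Set.mem_singleton_iff, ← eq_sub_iff_add_eq, exists_eq_left]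
    exact eq_comm
  have hB1 : CondB1' d φ3 φ4 := by
    intro a m m' hne
    rw [← Set.disjoint_iff_inter_eq_empty]
    rcases le_or_gt (-m).val ℓ with hm | hm <;> rcases le_or_gt (-m').val ℓ with hm' | hm'
    · rw [hsmall a m hm, hsmall a m' hm', Set.disjoint_singleton]
      exact fun h => hne (add_left_cancel h)
    · rw [hsmall a m hm, hlarge a m' hm', Set.disjoint_singleton]
      exact fun h => ZMod.add_ne_natCast_of_val_le_of_lt_val hd hm hm' (by linear_combination -h)
    · rw [hlarge a m hm, hsmall a m' hm', Set.disjoint_singleton]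
      exact fun h => ZMod.add_ne_natCast_of_val_le_of_lt_val hd hm' hm (by linear_combination h)
    · rw [hlarge a m hm, hlarge a m' hm', Set.disjoint_singleton]
      exact fun h => hne (by linear_combination -h)
  have hnonempty : ∀ a m : ZMod d, (XiSet d φ3 φ4 a m).Nonempty := by
    intro a m
    rcases le_or_gt (-m).val ℓ with hm | hm
    · rw [hsmall a m hm]
      exact Set.singleton_nonempty _
    · rw [hlarge a m hm]
      exact Set.singleton_nonempty _
  refine ⟨hB1, ⟨fun i => ⟨i, i - 1, ?_, ?_⟩, fun j => ⟨j, j - 1, ?_, ?_⟩⟩,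
    ⟨fun i => ⟨i - ℓ, i + 1, ?_, ?_⟩, fun j => ⟨j, j + ℓ, ?_, ?_⟩⟩,
    fun a m => ⟨hsmall a m, hlarge a m⟩, fun a m m' hne h => ?_⟩
  · exact fun h => one_ne_zero (sub_eq_self.1 h.symm)
  · simp [hφ3, hval_one, hℓ]
  · exact fun h => one_ne_zero (sub_eq_self.1 h.symm)
  · have : j - 1 - j = -1 := by ring
    rw [hφ3, hφ3, sub_self, this, ZMod.val_zero, hval_neg_one, if_pos (by omega), if_neg (by omega)]
  · intro h
    have : (ℓ : ZMod d) = -1 := by linear_combination -h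
    rw [this, hval_neg_one] at hval_ℓ
    omega
  · rw [hφ4, hφ4, hdiff, sub_sub_cancel, hval_ℓ, hval_neg_one, if_pos (by omega),
      if_pos (by omega)]
  · simpa using hℓ0
  · rw [hφ4, hφ4, sub_self, add_sub_cancel_left, ZMod.val_zero, hval_ℓ, if_neg (by omega),
      if_pos (by omega), add_sub_cancel_right]
  · have hempty := hB1 a m m' hne
    rw [← h, Set.inter_self] at hempty
    exact (hnonempty a m).ne_empty hempty
end

section
/- Let M, Y1, Y2 be random variables on a finite probability space with Y1, Y2 taking values in Z_d, let (Y3, Y4) be a deterministic function of (Y1, Y2), and suppose M is a deterministic function of (Y3, Y4). Then for each i ∈ {1, 2}, the Shannon mutual informations (natural logarithm) satisfy I(M; (Y_i, Y3)) + I(M; (Y_i, Y4)) ≥ 2·H(M) − log d. -/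
/-- Shannon entropy (natural logarithm) of a random variable on a finite probability
space with probability mass function `P`. -/
noncomputable def entW {Ω A : Type*} [Fintype Ω] [Fintype A] (P : Ω → ℝ) (X : Ω → A) : ℝ :=
  -∑ a : A, prW P (fun ω => X ω = a) * Real.log (prW P (fun ω => X ω = a))

/-- Shannon mutual information (natural logarithm). -/
noncomputable def miW {Ω A B : Type*} [Fintype Ω] [Fintype A] [Fintype B]
    (P : Ω → ℝ) (X : Ω → A) (Y : Ω → B) : ℝ :=
  entW P X + entW P Y - entW P (fun ω => (X ω, Y ω))

section FiniteEntropy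

variable {Ω A B C : Type*} [Fintype Ω] [Fintype A] [Fintype B] [Fintype C] {P : Ω → ℝ}

lemma sum_prW_mul (P : Ω → ℝ) (X : Ω → A) (h : A → ℝ) :
    ∑ a, prW P (fun ω => X ω = a) * h a = ∑ ω, P ω * h (X ω) := by
  classical
  simp only [prW, Finset.sum_mul]
  rw [Finset.sum_comm]
  refine Finset.sum_congr rfl fun ω _ => ?_
  rw [Finset.sum_eq_single (X ω)]
  · simp
  · intro b _ hb
    simp [hb.symm]
  · simp

lemma sum_prW (P : Ω → ℝ) (X : Ω → A) : ∑ a, prW P (fun ω => X ω = a) = ∑ ω, P ω := by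
  simpa using sum_prW_mul P X fun _ => 1

lemma entW_eq_neg_sum (P : Ω → ℝ) (X : Ω → A) :
    entW P X = -∑ ω, P ω * Real.log (prW P fun ω' => X ω' = X ω) := by
  rw [entW, sum_prW_mul P X fun a => Real.log (prW P fun ω => X ω = a)]

lemma prW_nonneg (hP : ∀ ω, 0 ≤ P ω) (E : Ω → Prop) : 0 ≤ prW P E := by
  unfold prW
  exact Finset.sum_nonneg fun ω _ => by split_ifs <;> simp [hP ω]

lemma prW_mono (hP : ∀ ω, 0 ≤ P ω) {E F : Ω → Prop} (h : ∀ ω, E ω → F ω) :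
    prW P E ≤ prW P F := by
  unfold prW
  refine Finset.sum_le_sum fun ω _ => ?_
  by_cases hE : E ω
  · simp [hE, h ω hE]
  · by_cases hF : F ω <;> simp [hE, hF, hP ω]

lemma le_prW (hP : ∀ ω, 0 ≤ P ω) {E : Ω → Prop} {ω : Ω} (h : E ω) : P ω ≤ prW P E := by
  classical
  calc P ω = if E ω then P ω else 0 := by simp [h]
    _ ≤ prW P E := by
      unfold prW
      convert Finset.single_le_sum (f := fun ω => if E ω then P ω else 0)
        (fun i _ => ?_) (Finset.mem_univ ω)
      show 0 ≤ if E i then P i else 0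
      split_ifs <;> simp [hP i]

lemma prW_marginal {S : Type*} (P : Ω → ℝ) (X : Ω → S) (Y : Ω → B) (a : S) :
    ∑ b, prW P (fun ω => (X ω, Y ω) = (a, b)) = prW P (fun ω => X ω = a) := by
  classical
  simp only [prW, Prod.mk.injEq]
  rw [Finset.sum_comm]
  refine Finset.sum_congr rfl fun ω _ => ?_
  by_cases h : X ω = a <;> simp [h]

/-- Entropy does not increase under a deterministic map. -/
lemma entW_le_of_comp (hP : ∀ ω, 0 ≤ P ω) {X : Ω → A} {Z : Ω → B} (g : B → A)
    (h : ∀ ω, X ω = g (Z ω)) : entW P X ≤ entW P Z := by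
  rw [entW_eq_neg_sum, entW_eq_neg_sum, neg_le_neg_iff]
  refine Finset.sum_le_sum fun ω _ => ?_
  rcases (hP ω).eq_or_lt with h0 | h0
  · simp [← h0]
  · refine mul_le_mul_of_nonneg_left (Real.log_le_log (h0.trans_le (le_prW hP rfl)) ?_) h0.le
    exact prW_mono hP fun ω' hω' => by rw [h, h, hω']

/-- Gibbs' inequality: entropy is at most the cross entropy with a subprobability vector. -/
lemma entW_le_cross_entropy (hP : ∀ ω, 0 ≤ P ω) (hP1 : ∑ ω, P ω = 1) (X : Ω → A) (q : A → ℝ)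
    (hq : ∀ a, 0 ≤ q a) (hq1 : ∑ a, q a ≤ 1) (hpos : ∀ ω, 0 < P ω → 0 < q (X ω)) :
    entW P X ≤ -∑ ω, P ω * Real.log (q (X ω)) := by
  set p : A → ℝ := fun a => prW P fun ω => X ω = a
  have key : ∀ ω, P ω * (1 - q (X ω) / p (X ω)) ≤
      P ω * Real.log (p (X ω)) - P ω * Real.log (q (X ω)) := fun ω => by
    rcases (hP ω).eq_or_lt with h0 | h0
    · simp [← h0]
    · have h1 : 0 < p (X ω) := h0.trans_le (le_prW hP rfl)
      have h2 := hpos ω h0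
      have h3 := Real.log_le_sub_one_of_pos (div_pos h2 h1)
      rw [Real.log_div h2.ne' h1.ne'] at h3
      rw [← mul_sub]
      exact mul_le_mul_of_nonneg_left (by linarith) h0.le
  have hsum : 0 ≤ ∑ ω, P ω * (1 - q (X ω) / p (X ω)) := by
    simp only [mul_sub, mul_one, Finset.sum_sub_distrib, hP1]
    rw [← sum_prW_mul P X fun a => q a / p a]
    have : ∑ a, p a * (q a / p a) ≤ ∑ a, q a := Finset.sum_le_sum fun a _ => by
      by_cases h : p a = 0
      · simpa [h] using hq a
      · rw [mul_div_cancel₀ _ h]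
    linarith
  have := hsum.trans (Finset.sum_le_sum fun ω _ => key ω)
  rw [Finset.sum_sub_distrib] at this
  rw [entW_eq_neg_sum]
  linarith

lemma entW_pair_le_add_log_card [Nonempty B] (hP : ∀ ω, 0 ≤ P ω) (hP1 : ∑ ω, P ω = 1)
    (X : Ω → A) (Y : Ω → B) :
    entW P (fun ω => (X ω, Y ω)) ≤ entW P X + Real.log (Fintype.card B) := by
  have hc : (0 : ℝ) < Fintype.card B := by exact_mod_cast Fintype.card_pos
  have hX : ∀ ω, 0 < P ω → 0 < prW P (fun ω' => X ω' = X ω) := fun ω h0 =>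
    h0.trans_le (le_prW hP rfl)
  refine (entW_le_cross_entropy hP hP1 _
    (fun z => prW P (fun ω => X ω = z.1) / Fintype.card B)
    (fun z => div_nonneg (prW_nonneg hP _) hc.le) ?_ fun ω h0 => div_pos (hX ω h0) hc).trans_eq ?_
  · rw [Fintype.sum_prod_type]
    simp [mul_div_cancel₀ _ hc.ne', sum_prW, hP1]
  · have : ∀ ω, P ω * Real.log (prW P (fun ω' => X ω' = X ω) / Fintype.card B) =
        P ω * Real.log (prW P (fun ω' => X ω' = X ω)) - P ω * Real.log (Fintype.card B) :=
      fun ω => by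
        rcases (hP ω).eq_or_lt with h0 | h0
        · simp [← h0]
        · rw [Real.log_div (hX ω h0).ne' hc.ne', mul_sub]
    simp only [this, Finset.sum_sub_distrib, ← Finset.sum_mul, hP1, entW_eq_neg_sum]
    ring

/-- Submodularity of entropy. -/
lemma entW_submodular (hP : ∀ ω, 0 ≤ P ω) (hP1 : ∑ ω, P ω = 1)
    (X : Ω → A) (Y : Ω → B) (Z : Ω → C) :
    entW P (fun ω => (X ω, Y ω, Z ω)) + entW P X ≤
      entW P (fun ω => (X ω, Y ω)) + entW P (fun ω => (X ω, Z ω)) := by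
  set pX : A → ℝ := fun a => prW P fun ω => X ω = a
  set pY : A × B → ℝ := fun a => prW P fun ω => (X ω, Y ω) = a
  set pZ : A × C → ℝ := fun a => prW P fun ω => (X ω, Z ω) = a
  have hX : ∀ ω, 0 < P ω → 0 < pX (X ω) := fun ω h0 => h0.trans_le (le_prW hP rfl)
  have hY : ∀ ω, 0 < P ω → 0 < pY (X ω, Y ω) := fun ω h0 => h0.trans_le (le_prW hP rfl)
  have hZ : ∀ ω, 0 < P ω → 0 < pZ (X ω, Z ω) := fun ω h0 => h0.trans_le (le_prW hP rfl)
  have hsumY : ∀ a, ∑ b, pY (a, b) = pX a := prW_marginal P X Y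
  have hsumZ : ∀ a, ∑ c, pZ (a, c) = pX a := prW_marginal P X Z
  have gibbs := entW_le_cross_entropy hP hP1 (fun ω => (X ω, Y ω, Z ω))
    (fun t => pY (t.1, t.2.1) * pZ (t.1, t.2.2) / pX t.1)
    (fun t => div_nonneg (mul_nonneg (prW_nonneg hP _) (prW_nonneg hP _)) (prW_nonneg hP _))
    (by
      simp only [Fintype.sum_prod_type, ← Finset.sum_div, ← Finset.mul_sum, ← Finset.sum_mul,
        hsumY, hsumZ, mul_self_div_self]
      exact (sum_prW P X).trans_le hP1.le)
    (fun ω h0 => div_pos (mul_pos (hY ω h0) (hZ ω h0)) (hX ω h0))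
  have hlog : ∀ ω, P ω * Real.log (pY (X ω, Y ω) * pZ (X ω, Z ω) / pX (X ω)) =
      P ω * Real.log (pY (X ω, Y ω)) + P ω * Real.log (pZ (X ω, Z ω))
        - P ω * Real.log (pX (X ω)) := fun ω => by
    rcases (hP ω).eq_or_lt with h0 | h0
    · simp [← h0]
    · rw [Real.log_div (mul_pos (hY ω h0) (hZ ω h0)).ne' (hX ω h0).ne',
        Real.log_mul (hY ω h0).ne' (hZ ω h0).ne']
      ring
  simp only [hlog, Finset.sum_sub_distrib, Finset.sum_add_distrib] at gibbs
  have eX : entW P X = -∑ ω, P ω * Real.log (pX (X ω)) := entW_eq_neg_sum P X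
  have eY : entW P (fun ω => (X ω, Y ω)) = -∑ ω, P ω * Real.log (pY (X ω, Y ω)) :=
    entW_eq_neg_sum P _
  have eZ : entW P (fun ω => (X ω, Z ω)) = -∑ ω, P ω * Real.log (pZ (X ω, Z ω)) :=
    entW_eq_neg_sum P _
  linarith

end FiniteEntropy

/-- if `(Y3, Y4)` is a deterministic function of `(Y1, Y2)` (with `Y1, Y2, Y3,
Y4` taking values in `Z_d`) and `M` is a deterministic function of `(Y3, Y4)`, then for each
`i ∈ {1, 2}` one has `I(M; (Y_i, Y3)) + I(M; (Y_i, Y4)) ≥ 2 H(M) - log d`. -/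
theorem leaked_information_lower_bound
    (Ω MT : Type) [Fintype Ω] [Fintype MT] (d : ℕ) [NeZero d]
    (P : Ω → ℝ) (hP0 : ∀ ω, 0 ≤ P ω) (hP1 : ∑ ω : Ω, P ω = 1)
    (M : Ω → MT) (Y1 Y2 Y3 Y4 : Ω → ZMod d)
    (hdet : ∃ f : ZMod d × ZMod d → ZMod d × ZMod d,
      ∀ ω, (Y3 ω, Y4 ω) = f (Y1 ω, Y2 ω))
    (hrec : ∃ g : ZMod d × ZMod d → MT, ∀ ω, M ω = g (Y3 ω, Y4 ω)) :
    ∀ Yi : Ω → ZMod d, (Yi = Y1 ∨ Yi = Y2) →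
      miW P M (fun ω => (Yi ω, Y3 ω)) + miW P M (fun ω => (Yi ω, Y4 ω))
        ≥ 2 * entW P M - Real.log d := by
  obtain ⟨f, hf⟩ := hdet
  obtain ⟨g, hg⟩ := hrec
  intro Y hY
  obtain ⟨Y', k, hk⟩ : ∃ (Y' : Ω → ZMod d) (k : ZMod d × ZMod d → ZMod d × ZMod d),
      ∀ ω, (Y3 ω, Y4 ω) = k (Y ω, Y' ω) := by
    rcases hY with rfl | rfl
    · exact ⟨Y2, f, hf⟩
    · exact ⟨Y1, fun z => f z.swap, hf⟩
  have h3 : entW P (fun ω => (M ω, (Y ω, Y3 ω))) ≤ entW P (fun ω => (Y ω, Y3 ω, Y4 ω)) :=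
    entW_le_of_comp hP0 (fun t => (g t.2, (t.1, t.2.1))) fun ω => by simp [hg]
  have h4 : entW P (fun ω => (M ω, (Y ω, Y4 ω))) ≤ entW P (fun ω => (Y ω, Y3 ω, Y4 ω)) :=
    entW_le_of_comp hP0 (fun t => (g t.2, (t.1, t.2.2))) fun ω => by simp [hg]
  have h34 : entW P (fun ω => (Y ω, Y3 ω, Y4 ω)) ≤ entW P (fun ω => (Y ω, Y' ω)) :=
    entW_le_of_comp hP0 (fun t => (t.1, k t)) fun ω => by simp [hk]
  have hcard := entW_pair_le_add_log_card hP0 hP1 Y Y'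
  rw [ZMod.card] at hcard
  have hsub := entW_submodular hP0 hP1 Y Y3 Y4
  simp only [miW]
  linarith
end

section
/- Let q' be a prime power and n, m positive integers. Let V_1, …, V_m be independent random variables, each uniformly distributed on the finite field F_{q'}, and define the random n×m matrix U by U_{i,j} := (V_j)^i for 1 ≤ i ≤ n, 1 ≤ j ≤ m. Then for any two distinct row vectors x ≠ x' ∈ F_{q'}^n, the probability that x U = x' U is at most (n / q')^m. -/
open Polynomial in
/-- A nonzero polynomial of degree at most `n` without constant term, given by its coefficients,
vanishes on a set of at most `n` points. -/
theorem exists_finset_card_le_of_sum_mul_pow_succ_eq_zero {F : Type*} [Field F] {n : ℕ}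
    {c : Fin n → F} (hc : c ≠ 0) :
    ∃ S : Finset F, S.card ≤ n ∧ ∀ v : F, ∑ i, c i * v ^ ((i : ℕ) + 1) = 0 → v ∈ S := by
  classical
  let p : F[X] := ∑ i : Fin n, C (c i) * X ^ ((i : ℕ) + 1)
  have hcoeff (k : Fin n) : p.coeff ((k : ℕ) + 1) = c k := by
    simp [p, coeff_C_mul, coeff_X_pow, Fin.val_inj]
  have hp : p ≠ 0 := fun h => hc <| funext fun k => by simp [← hcoeff k, h]
  have hdeg : p.natDegree ≤ n := natDegree_sum_le_of_forall_le _ _ fun i _ =>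
    (natDegree_C_mul_X_pow_le _ _).trans i.isLt
  refine ⟨p.roots.toFinset, (Multiset.toFinset_card_le _).trans ((card_roots' p).trans hdeg),
    fun v hv => ?_⟩
  simpa [hp, IsRoot.def, p, eval_finsetSum] using hv

/-- If every coordinate of each point of an event in `F ^ m` lies in `S`, then the event has
probability at most `(#S / #F) ^ m`. -/
theorem prU_pi_le_of_forall_mem {F : Type*} [Fintype F] {m : ℕ} {E : (Fin m → F) → Prop}
    (S : Finset F) (hE : ∀ V, E V → ∀ j, V j ∈ S) :
    prU E ≤ ((S.card : ℝ) / (Fintype.card F : ℝ)) ^ m := by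
  classical
  have hcard : Nat.card {V // E V} ≤ S.card ^ m := by
    rw [Nat.card_eq_fintype_card, Fintype.card_subtype]
    calc _ ≤ (Fintype.piFinset fun _ : Fin m => S).card :=
          Finset.card_le_card fun V hV => Fintype.mem_piFinset.2 (hE V (Finset.mem_filter.1 hV).2)
      _ = S.card ^ m := by simp
  rw [prU, div_pow, Fintype.card_fun, Fintype.card_fin, Nat.cast_pow]
  gcongr
  exact_mod_cast hcard

/-- for `V_1, …, V_m` independent uniform on the finite field `F` (with `q'`
elements) and the random `n × m` matrix `U` with `U_{i,j} = (V_j)^i` (`1 ≤ i ≤ n`), any two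
distinct row vectors `x ≠ x'` satisfy `Pr[x U = x' U] ≤ (n / q')^m`. -/
theorem vandermonde_collision_probability
    (F : Type) [Field F] [Fintype F] (n m : ℕ) (hn : 0 < n) (hm : 0 < m)
    (x x' : Fin n → F) (hxx : x ≠ x') :
    prU (fun V : Fin m → F =>
        Matrix.vecMul x (Matrix.of fun (i : Fin n) (j : Fin m) => V j ^ ((i : ℕ) + 1)) =
        Matrix.vecMul x' (Matrix.of fun (i : Fin n) (j : Fin m) => V j ^ ((i : ℕ) + 1)))
      ≤ ((n : ℝ) / (Fintype.card F : ℝ)) ^ m := by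
  obtain ⟨S, hS, hroot⟩ :=
    exists_finset_card_le_of_sum_mul_pow_succ_eq_zero (sub_ne_zero.2 hxx)
  refine (prU_pi_le_of_forall_mem S fun V hV j => hroot (V j) ?_).trans (by gcongr)
  simpa [Matrix.vecMul, dotProduct, sub_mul, sub_eq_zero] using congrFun hV j
end

section
/- Let M, Y_i, Y_j be random variables on a finite probability space taking finitely many values. If M and Y_i are independent and Y_j is a deterministic function of the pair (M, Y_i), then the Shannon mutual information satisfies I(M; (Y_i, Y_j)) = H(Y_j | Y_i). -/
/-- Conditional Shannon entropy `H(Y | X) = H(X, Y) - H(X)`. -/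
noncomputable def condEntW {Ω A B : Type*} [Fintype Ω] [Fintype A] [Fintype B]
    (P : Ω → ℝ) (X : Ω → A) (Y : Ω → B) : ℝ :=
  entW P (fun ω => (X ω, Y ω)) - entW P X

theorem sum_prW_eq {Ω A : Type*} [Fintype Ω] [Fintype A] (P : Ω → ℝ) (X : Ω → A) :
    ∑ a : A, prW P (fun ω => X ω = a) = ∑ ω : Ω, P ω := by
  unfold prW
  rw [Finset.sum_comm]
  exact Finset.sum_congr rfl fun ω _ => by classical simp

theorem entW_eq_sum_negMulLog {Ω A : Type*} [Fintype Ω] [Fintype A] (P : Ω → ℝ) (X : Ω → A) :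
    entW P X = ∑ a : A, Real.negMulLog (prW P (fun ω => X ω = a)) := by
  simp [entW, Real.negMulLog]

/-- Entropy is invariant under injective relabelling of the values. -/
theorem entW_comp_of_injective {Ω A B : Type*} [Fintype Ω] [Fintype A] [Fintype B] (P : Ω → ℝ)
    (X : Ω → A) {g : A → B} (hg : Function.Injective g) :
    entW P (fun ω => g (X ω)) = entW P X := by
  unfold entW
  congr 1
  symm
  refine Fintype.sum_of_injective g hg _ _ (fun b hb => ?_) (fun a => ?_)
  · have h : ∀ ω, g (X ω) ≠ b := fun ω h => hb ⟨X ω, h⟩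
    simp [prW, h]
  · simp only [hg.eq_iff]

/-- Entropy is additive on independent pairs. -/
theorem entW_prodMk_of_indep {Ω A B : Type*} [Fintype Ω] [Fintype A] [Fintype B] {P : Ω → ℝ}
    (hP1 : ∑ ω : Ω, P ω = 1) {X : Ω → A} {Y : Ω → B}
    (hindep : ∀ (a : A) (b : B),
      prW P (fun ω => X ω = a ∧ Y ω = b) =
        prW P (fun ω => X ω = a) * prW P (fun ω => Y ω = b)) :
    entW P (fun ω => (X ω, Y ω)) = entW P X + entW P Y := by
  have hX := (sum_prW_eq P X).trans hP1
  have hY := (sum_prW_eq P Y).trans hP1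
  simp only [entW_eq_sum_negMulLog, Fintype.sum_prod_type, Prod.mk.injEq, hindep]
  simp only [Real.negMulLog_mul, Finset.sum_add_distrib, ← Finset.sum_mul, ← Finset.mul_sum,
    hX, hY, one_mul]

/-- if `M` and `Y_i` are independent and `Y_j` is a deterministic function of
`(M, Y_i)`, then `I(M; (Y_i, Y_j)) = H(Y_j | Y_i)`. -/
theorem mutualInfo_eq_condEntropy_of_indep
    (Ω A B C : Type) [Fintype Ω] [Fintype A] [Fintype B] [Fintype C]
    (P : Ω → ℝ) (hP0 : ∀ ω, 0 ≤ P ω) (hP1 : ∑ ω : Ω, P ω = 1)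
    (M : Ω → A) (Yi : Ω → B) (Yj : Ω → C)
    (hindep : ∀ (a : A) (b : B),
      prW P (fun ω => M ω = a ∧ Yi ω = b) =
        prW P (fun ω => M ω = a) * prW P (fun ω => Yi ω = b))
    (hdet : ∃ f : A × B → C, ∀ ω, Yj ω = f (M ω, Yi ω)) :
    miW P M (fun ω => (Yi ω, Yj ω)) = condEntW P Yi Yj := by
  obtain ⟨f, hf⟩ := hdet
  have hg : Function.Injective (fun p : A × B => (p.1, (p.2, f p))) := by
    rintro ⟨a, b⟩ ⟨a', b'⟩ h
    simp_all
  have h := entW_comp_of_injective P (fun ω => (M ω, Yi ω)) hg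
  simp only [← hf, entW_prodMk_of_indep hP1 hindep] at h
  rw [miW, condEntW, h]
  ring
end
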